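/- arXiv:2008.06824 — 2 statements merged into one kernel-verified Lean document; each statement's English description precedes it below -/
import Mathlib

section
/- Every c-acyclic finite structure with k distinguished elements that has the Unique Names Property has a finite frontier with respect to the class of all finite structures, consisting entirely of structures that have the Unique Names Property; moreover such a frontier can be constructed in polynomial time (for fixed schema and k). -/
/-- A finite relational structure over a schema `S` (with arity function `ar`)
with `k` distinguished elements. -/
structure PStruct (S : Type) (ar : S → ℕ) (k : ℕ) : Type 1 where
  dom : Type
  finite : Finite dom
  facts : ∀ R : S, Set (Fin (ar R) → dom)
  dist : Fin k → dom

attribute [instance] PStruct.finite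

namespace PStruct

variable {S : Type} {ar : S → ℕ} {k : ℕ}

/-- `h` is a homomorphism from `A` to `B`: it preserves all facts and maps
distinguished elements to corresponding distinguished elements. -/
def IsHom (A B : PStruct S ar k) (h : A.dom → B.dom) : Prop :=
  (∀ (R : S) (t : Fin (ar R) → A.dom), t ∈ A.facts R → (fun i => h (t i)) ∈ B.facts R) ∧
  ∀ i : Fin k, h (A.dist i) = B.dist i

/-- `(A,𝐚) → (B,𝐛)`: a homomorphism exists. -/
def HomTo (A B : PStruct S ar k) : Prop := ∃ h, IsHom A B h

/-- Homomorphic equivalence. -/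
def HomEquiv (A B : PStruct S ar k) : Prop := HomTo A B ∧ HomTo B A

/-- Direct product of two structures with distinguished elements. -/
def prod (A B : PStruct S ar k) : PStruct S ar k where
  dom := A.dom × B.dom
  finite := inferInstance
  facts R := {t | (fun i => (t i).1) ∈ A.facts R ∧ (fun i => (t i).2) ∈ B.facts R}
  dist i := (A.dist i, B.dist i)

/-- The facts of a structure, as a type. -/
def Fact (A : PStruct S ar k) : Type := Σ R : S, {t : Fin (ar R) → A.dom // t ∈ A.facts R}

/-- Occurrences of elements in facts: a fact together with a position in it. -/
def Occ (A : PStruct S ar k) : Type :=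
  Σ R : S, {t : Fin (ar R) → A.dom // t ∈ A.facts R} × Fin (ar R)

def Occ.fact {A : PStruct S ar k} (o : Occ A) : Fact A := ⟨o.1, o.2.1⟩

def Occ.elem {A : PStruct S ar k} (o : Occ A) : A.dom := o.2.1.1 o.2.2

/-- Vertices of the (subdivided) incidence graph: elements, occurrences, and facts.
Each occurrence vertex subdivides one edge of the bipartite incidence multigraph,
so that cycles (resp. connectivity) of the incidence multigraph correspond exactly to
cycles (resp. connectivity) of this simple graph. -/
def IncV (A : PStruct S ar k) : Type := A.dom ⊕ (Occ A ⊕ Fact A)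

/-- The incidence graph of a structure, as a simple graph (with each
element-occurrence-in-a-fact edge of the incidence multigraph subdivided). -/
def incGraph (A : PStruct S ar k) : SimpleGraph (IncV A) where
  Adj v w := ∃ o : Occ A,
    (v = Sum.inl o.elem ∧ w = Sum.inr (Sum.inl o)) ∨
    (w = Sum.inl o.elem ∧ v = Sum.inr (Sum.inl o)) ∨
    (v = Sum.inr (Sum.inl o) ∧ w = Sum.inr (Sum.inr o.fact)) ∨
    (w = Sum.inr (Sum.inl o) ∧ v = Sum.inr (Sum.inr o.fact))
  symm := by
    constructor
    rintro v w ⟨o, h⟩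
    exact ⟨o, by tauto⟩
  loopless := by
    constructor
    rintro v ⟨o, (⟨h1, h2⟩ | ⟨h1, h2⟩ | ⟨h1, h2⟩ | ⟨h1, h2⟩)⟩ <;> rw [h1] at h2 <;>
      first
      | exact Sum.inl_ne_inr h2
      | exact Sum.inl_ne_inr (Sum.inr.inj h2)

/-- A structure is acyclic if its incidence graph is acyclic (Berge acyclicity). -/
def Acyclic (A : PStruct S ar k) : Prop := (incGraph A).IsAcyclic

/-- A structure is c-acyclic if every cycle of its incidence graph passes through
a distinguished element. -/
def CAcyclic (A : PStruct S ar k) : Prop :=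
  ∀ (v : IncV A) (c : (incGraph A).Walk v v), c.IsCycle →
    ∃ i : Fin k, Sum.inl (A.dist i) ∈ c.support

/-- A structure is c-connected if every connected component of its incidence graph
contains a distinguished element. -/
def CConnected (A : PStruct S ar k) : Prop :=
  ∀ v : IncV A, ∃ i : Fin k, (incGraph A).Reachable (Sum.inl (A.dist i)) v

/-- The incidence graph is connected. -/
def IncConnected (A : PStruct S ar k) : Prop := (incGraph A).Connected

/-- The fact graph: vertices are facts, with an edge between distinct facts that
share a non-distinguished element. -/
def factGraph (A : PStruct S ar k) : SimpleGraph (Fact A) where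
  Adj f g := f ≠ g ∧ ∃ b : A.dom, (∀ i, b ≠ A.dist i) ∧ (∃ j, f.2.1 j = b) ∧ (∃ j, g.2.1 j = b)
  symm := by
    constructor
    rintro f g ⟨hne, b, h1, h2, h3⟩
    exact ⟨hne.symm, b, h1, h3, h2⟩
  loopless := by constructor; rintro f ⟨hne, -⟩; exact hne rfl

/-- A structure is fg-connected if its fact graph is connected. -/
def FgConnected (A : PStruct S ar k) : Prop := (factGraph A).Connected

/-- A structure is a core if it admits no homomorphism to a proper substructure,
i.e. every endomorphism is surjective on elements and on facts. -/
def IsCore (A : PStruct S ar k) : Prop :=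
  ∀ h : A.dom → A.dom, IsHom A A h →
    Function.Surjective h ∧
    ∀ (R : S) (t : Fin (ar R) → A.dom), t ∈ A.facts R →
      ∃ s ∈ A.facts R, (fun i => h (s i)) = t

/-- Unique Names Property: the distinguished elements are pairwise distinct. -/
def UNP (A : PStruct S ar k) : Prop := Function.Injective A.dist

/-- A structure is safe if every distinguished element occurs in at least one fact. -/
def Safe (A : PStruct S ar k) : Prop :=
  ∀ i : Fin k, ∃ (R : S) (t : Fin (ar R) → A.dom), t ∈ A.facts R ∧ ∃ j, t j = A.dist i

/-- A structure is (the canonical structure of) a conjunctive query iff every element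
occurs in at least one fact (in particular it is safe). -/
def IsCQ (A : PStruct S ar k) : Prop :=
  ∀ x : A.dom, ∃ (R : S) (t : Fin (ar R) → A.dom), t ∈ A.facts R ∧ ∃ j, t j = x

/-- The size of a structure: its number of facts. -/
noncomputable def size (A : PStruct S ar k) : ℕ := Nat.card (Fact A)

/-- The total size of a set of structures: the sum of (size + 1) over its members. -/
noncomputable def totalSize (F : Set (PStruct S ar k)) : ℕ := ∑ᶠ B ∈ F, (size B + 1)

/-- `F` is a frontier for `A` with respect to the class `C`. -/
def IsFrontier (C : Set (PStruct S ar k)) (A : PStruct S ar k)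
    (F : Set (PStruct S ar k)) : Prop :=
  F.Finite ∧
  (∀ B ∈ F, HomTo B A) ∧
  (∀ B ∈ F, ¬ HomTo A B) ∧
  ∀ C' ∈ C, HomTo C' A → ¬ HomTo A C' → ∃ B ∈ F, HomTo C' B

/-- `D` is a finite duality for `A` with respect to the class `C`. -/
def IsDuality (C : Set (PStruct S ar k)) (A : PStruct S ar k)
    (D : Set (PStruct S ar k)) : Prop :=
  D.Finite ∧ ∀ C' ∈ C, (HomTo A C' ↔ ∀ B ∈ D, ¬ HomTo C' B)

/-- A conjunctive query (given by its canonical structure `Q`) fits the example sets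
`(E⁺, E⁻)`: every example in `E⁺` is positive and every example in `E⁻` is negative.
(By Chandra–Merlin, `(A,𝐚)` is a positive example for `Q` iff `Q → (A,𝐚)`.) -/
def Fits (Q : PStruct S ar k) (Ep Em : Set (PStruct S ar k)) : Prop :=
  (∀ E ∈ Ep, HomTo Q E) ∧ (∀ E ∈ Em, ¬ HomTo Q E)

/-- `(E⁺, E⁻)` uniquely characterizes the CQ `Q` with respect to the class `C` of CQs
(all represented by their canonical structures): `Q` fits, and every member of `C`
that fits is logically equivalent (i.e. homomorphically equivalent) to `Q`. -/
def UniquelyCharacterizes (Ep Em : Set (PStruct S ar k)) (Q : PStruct S ar k)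
    (C : Set (PStruct S ar k)) : Prop :=
  Fits Q Ep Em ∧ ∀ Q' ∈ C, Fits Q' Ep Em → HomEquiv Q Q'

end PStruct

open PStruct

namespace PStruct

theorem orient {V : Type} (G : SimpleGraph V) (h : G.IsAcyclic) (rt : V → V)
    (hr : ∀ v, G.Reachable (rt v) v) (hc : ∀ u v, G.Adj u v → rt u = rt v) :
    ∃ (par : V → Option V) (rk : V → ℕ),
      (∀ u v, G.Adj u v → par u = some v ∨ par v = some u) ∧
      (∀ u v, par u = some v → G.Adj u v ∧ rk v < rk u) ∧
      ∀ v, par v = none → v = rt v := by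
  classical
  have hP : ∀ v, ∃ p : G.Walk (rt v) v, p.IsPath := fun v => by
    obtain ⟨p⟩ := hr v
    exact ⟨p.toPath.1, p.toPath.2⟩
  choose P hP using hP
  have aux : ∀ (u v r r' : V) (p : G.Walk r u) (q : G.Walk r' v), r = r' → p.IsPath → q.IsPath →
      G.Adj u v → v ∈ p.support →
      ¬ p.Nil ∧ p.penultimate = v ∧ q.length < p.length := by
    intro u v r r' p q hrr hp hq ha hv
    subst hrr
    have := h.path_concat hq hp ha.symm hv
    subst this
    refine ⟨?_, ?_, ?_⟩
    · rw [← SimpleGraph.Walk.length_eq_zero_iff]; simp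
    · simp
    · simp
  have aux2 : ∀ (u v r r' : V) (p : G.Walk r u) (q : G.Walk r' v), r = r' → p.IsPath → q.IsPath →
      G.Adj u v → v ∈ p.support ∨ u ∈ q.support := by
    intro u v r r' p q hrr hp hq ha
    subst hrr
    by_contra hcon
    push Not at hcon
    exact hcon.2 (h.mem_support_of_ne_mem_support_of_adj_of_isPath hq hp ha.symm hcon.1)
  refine ⟨fun v => if (P v).Nil then none else some (P v).penultimate, fun v => (P v).length,
    ?_, ?_, ?_⟩
  · intro u v ha
    rcases aux2 u v _ _ (P u) (P v) (hc _ _ ha) (hP u) (hP v) ha with h1 | h1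
    · have := aux u v _ _ (P u) (P v) (hc _ _ ha) (hP u) (hP v) ha h1
      left; simp [this]
    · have := aux v u _ _ (P v) (P u) (hc _ _ ha).symm (hP v) (hP u) ha.symm h1
      right; simp [this]
  · intro u v hp
    by_cases hn : (P u).Nil
    · simp [hn] at hp
    · simp only [hn, if_false, Option.some.injEq] at hp
      subst hp
      have ha := (SimpleGraph.Walk.adj_penultimate hn).symm
      exact ⟨ha, (aux u _ _ _ (P u) (P _) (hc _ _ ha) (hP u) (hP _) ha (by simp)).2.2⟩
  · intro v hv
    by_cases hn : (P v).Nil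
    · exact hn.eq.symm
    · simp [hn] at hv

variable {S : Type} {ar : S → ℕ} {k : ℕ}

/-- non-distinguished elements -/
def ND (A : PStruct S ar k) (u : A.dom) : Prop := ∀ i, u ≠ A.dist i

def tup {A : PStruct S ar k} (f : Fact A) : Fin (ar f.1) → A.dom := f.2.1

/-- A rooted-forest orientation of the incidence graph without distinguished elements. -/
structure Orient (A : PStruct S ar k) where
  pos : (f : Fact A) → Option (Fin (ar f.1))
  up : A.dom → Option (Σ f : Fact A, Fin (ar f.1))
  rE : A.dom → ℕ
  rF : Fact A → ℕ
  pos_nd : ∀ f j, pos f = some j → ND A (tup f j)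
  pos_lt : ∀ f j, pos f = some j → rE (tup f j) < rF f
  up_eq : ∀ f j, ND A (tup f j) → pos f ≠ some j → up (tup f j) = some ⟨f, j⟩
  up_lt : ∀ f j, ND A (tup f j) → pos f ≠ some j → rF f < rE (tup f j)
  up_none : ∀ u, ND A u → up u = none → ∀ f j, tup f j ≠ u
  up_some : ∀ u f j, up u = some ⟨f, j⟩ → tup f j = u ∧ pos f ≠ some j

/-- The incidence graph with the distinguished elements isolated. -/
def redGraph (A : PStruct S ar k) : SimpleGraph (IncV A) where
  Adj v w := (incGraph A).Adj v w ∧ (∀ i, v ≠ Sum.inl (A.dist i)) ∧ ∀ i, w ≠ Sum.inl (A.dist i)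
  symm := by
    constructor
    rintro v w ⟨h1, h2, h3⟩
    exact ⟨h1.symm, h3, h2⟩
  loopless := by
    constructor
    rintro v ⟨h1, -⟩
    exact (incGraph A).loopless.irrefl v h1

theorem redGraph_acyclic (A : PStruct S ar k) (hA : CAcyclic A) : (redGraph A).IsAcyclic := by
  classical
  intro v c hc
  have hle : redGraph A ≤ incGraph A := fun v w h => h.1
  obtain ⟨i, hi⟩ := hA v (c.mapLe hle) (hc.mapLe hle)
  have hi' : (Sum.inl (A.dist i) : IncV A) ∈ c.support := by simpa using hi
  have hr := hc.rotate hi'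
  have := SimpleGraph.Walk.adj_snd hr.not_nil
  exact this.2.1 i rfl

def occOf {A : PStruct S ar k} (f : Fact A) (j : Fin (ar f.1)) : Occ A := ⟨f.1, f.2, j⟩

theorem exists_orient (A : PStruct S ar k) (hA : CAcyclic A) : Nonempty (Orient A) := by
  classical
  let G := redGraph A
  let vE : A.dom → IncV A := fun u => Sum.inl u
  let vO : (f : Fact A) → Fin (ar f.1) → IncV A := fun f j => Sum.inr (Sum.inl (occOf f j))
  let vF : Fact A → IncV A := fun f => Sum.inr (Sum.inr f)
  let rc : G.ConnectedComponent → IncV A := fun c =>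
    if h : ∃ f, G.connectedComponentMk (vF f) = c then vF h.choose else c.out
  have hrc : ∀ c, G.connectedComponentMk (rc c) = c := by
    intro c
    by_cases h : ∃ f, G.connectedComponentMk (vF f) = c
    · simp only [rc, dif_pos h]; exact h.choose_spec
    · simp only [rc, dif_neg h]; exact Quot.out_eq c
  let rt : IncV A → IncV A := fun v => rc (G.connectedComponentMk v)
  obtain ⟨par, rk, h1, h2, h3⟩ := orient G (redGraph_acyclic A hA) rt
    (fun v => SimpleGraph.ConnectedComponent.exact (hrc _))
    (fun u v h => by
      have : G.connectedComponentMk u = G.connectedComponentMk v :=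
        SimpleGraph.ConnectedComponent.sound h.reachable
      simp only [rt, this])
  have adjOF : ∀ f j, G.Adj (vO f j) (vF f) := fun f j =>
    ⟨⟨occOf f j, Or.inr (Or.inr (Or.inl ⟨rfl, rfl⟩))⟩, fun i h => Sum.inr_ne_inl h,
      fun i h => Sum.inr_ne_inl h⟩
  have adjEO : ∀ f j, ND A (tup f j) → G.Adj (vE (tup f j)) (vO f j) := fun f j hn =>
    ⟨⟨occOf f j, Or.inl ⟨rfl, rfl⟩⟩, fun i h => hn i (Sum.inl_injective h),
      fun i h => Sum.inr_ne_inl h⟩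
  have rtF : ∀ v f, G.Reachable (vF f) v → ∃ f', rt v = vF f' := by
    intro v f hr
    have h : ∃ f, G.connectedComponentMk (vF f) = G.connectedComponentMk v :=
      ⟨f, SimpleGraph.ConnectedComponent.sound hr⟩
    exact ⟨h.choose, by simp only [rt, rc, dif_pos h]⟩
  have nbO : ∀ f j w, G.Adj (vO f j) w → w = vE (tup f j) ∨ w = vF f := by
    rintro f j w ⟨⟨o, h⟩, -, -⟩
    rcases h with ⟨h, h'⟩ | ⟨h, h'⟩ | ⟨h, h'⟩ | ⟨h, h'⟩
    · cases h
    · have : occOf f j = o := Sum.inl_injective (Sum.inr_injective h')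
      subst this; exact Or.inl h
    · have : occOf f j = o := Sum.inl_injective (Sum.inr_injective h)
      subst this; exact Or.inr h'
    · cases h'
  have nbE : ∀ u w, G.Adj (vE u) w → ∃ f j, w = vO f j ∧ tup f j = u := by
    rintro u w ⟨⟨o, h⟩, -, -⟩
    rcases h with ⟨h, h'⟩ | ⟨h, h'⟩ | ⟨h, h'⟩ | ⟨h, h'⟩
    · exact ⟨o.fact, o.2.2, h', (Sum.inl_injective h).symm⟩
    · cases h'
    · cases h
    · cases h'
  have vOinj : ∀ f j f' j', vO f j = vO f' j' →
      (⟨f, j⟩ : Σ f : Fact A, Fin (ar f.1)) = ⟨f', j'⟩ := by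
    rintro ⟨R, t⟩ j ⟨R', t'⟩ j' h
    have : occOf (A := A) ⟨R, t⟩ j = occOf ⟨R', t'⟩ j' := Sum.inl_injective (Sum.inr_injective h)
    simp only [occOf, Sigma.mk.injEq] at this
    obtain ⟨rfl, h⟩ := this
    simp only [heq_eq_eq, Prod.mk.injEq] at h
    obtain ⟨rfl, rfl⟩ := h
    rfl
  have parO : ∀ f j, par (vO f j) = some (vE (tup f j)) ∨ par (vO f j) = some (vF f) := by
    intro f j
    cases hp : par (vO f j) with
    | none =>
      obtain ⟨f', hf'⟩ := rtF (vO f j) f (adjOF f j).symm.reachable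
      have := h3 _ hp
      rw [hf'] at this
      cases this
    | some w =>
      rcases nbO f j w (h2 _ _ hp).1 with rfl | rfl <;> simp
  let D : (f : Fact A) → Fin (ar f.1) → Prop := fun f j => par (vO f j) = some (vE (tup f j))
  have D_nd : ∀ f j, D f j → ND A (tup f j) := fun f j h i hi =>
    (h2 _ _ h).1.2.2 i (by rw [← hi])
  have D_par : ∀ f j, D f j → par (vF f) = some (vO f j) := by
    intro f j h
    rcases h1 _ _ (adjOF f j) with h' | h'
    · have h : par (vO f j) = some (vE (tup f j)) := h
      rw [h] at h'; cases h'
    · exact h'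
  have nD_par : ∀ f j, ND A (tup f j) → ¬ D f j → par (vE (tup f j)) = some (vO f j) := by
    intro f j hn h
    rcases h1 _ _ (adjEO f j hn) with h' | h'
    · exact h'
    · exact absurd h' h
  let pos : (f : Fact A) → Option (Fin (ar f.1)) := fun f =>
    if h : ∃ j, D f j then some h.choose else none
  have pos_iff : ∀ f j, pos f = some j ↔ D f j := by
    intro f j
    by_cases h : ∃ j, D f j
    · simp only [pos, dif_pos h, Option.some.injEq]
      constructor
      · intro h'; rw [← h']; exact h.choose_spec
      · intro h'
        have e1 := D_par _ _ h'
        rw [D_par _ _ h.choose_spec] at e1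
        have := vOinj _ _ _ _ (Option.some.inj e1)
        simpa using this
    · simp only [pos, dif_neg h]
      constructor
      · intro h'; cases h'
      · intro h'; exact absurd ⟨j, h'⟩ h
  let up : A.dom → Option (Σ f : Fact A, Fin (ar f.1)) := fun u =>
    if h : ∃ p : Σ f : Fact A, Fin (ar f.1), par (vE u) = some (vO p.1 p.2) then some h.choose
    else none
  have up_iff : ∀ u p, up u = some p ↔ par (vE u) = some (vO p.1 p.2) := by
    intro u p
    by_cases h : ∃ p : Σ f : Fact A, Fin (ar f.1), par (vE u) = some (vO p.1 p.2)
    · simp only [up, dif_pos h, Option.some.injEq]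
      constructor
      · intro h'; rw [← h']; exact h.choose_spec
      · intro h'
        rw [h.choose_spec] at h'
        exact vOinj _ _ _ _ (Option.some.inj h')
    · simp only [up, dif_neg h]
      constructor
      · intro h'; cases h'
      · intro h'; exact absurd ⟨p, h'⟩ h
  refine ⟨⟨pos, up, fun u => rk (vE u), fun f => rk (vF f), ?_, ?_, ?_, ?_, ?_, ?_⟩⟩
  · intro f j h; exact D_nd f j ((pos_iff f j).1 h)
  · intro f j h
    have h := (pos_iff f j).1 h
    exact lt_trans (h2 _ _ h).2 (h2 _ _ (D_par f j h)).2
  · intro f j hn h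
    rw [ne_eq, pos_iff] at h
    exact (up_iff _ ⟨f, j⟩).2 (nD_par f j hn h)
  · intro f j hn h
    rw [ne_eq, pos_iff] at h
    refine lt_trans (h2 _ _ ?_).2 (h2 _ _ (nD_par f j hn h)).2
    exact (parO f j).resolve_left h
  · rintro u hn hu f j rfl
    cases hp : par (vE (tup f j)) with
    | none =>
      obtain ⟨f', hf'⟩ := rtF (vE (tup f j)) f
        ((adjOF f j).symm.reachable.trans (adjEO f j hn).symm.reachable)
      have := h3 _ hp
      rw [hf'] at this
      cases this
    | some w =>
      obtain ⟨f', j', rfl, h⟩ := nbE _ _ (h2 _ _ hp).1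
      have := (up_iff _ ⟨f', j'⟩).2 hp
      rw [hu] at this; cases this
  · intro u f j h
    have h := (up_iff _ _).1 h
    obtain ⟨f', j', e, h'⟩ := nbE _ _ (h2 _ _ h).1
    have e := vOinj _ _ _ _ e
    cases e
    refine ⟨h', ?_⟩
    rw [ne_eq, pos_iff]
    intro hD
    have a := (h2 _ _ h).2
    have b := (h2 _ _ hD).2
    rw [h'] at b
    exact lt_asymm a b

end PStruct

namespace PStruct

variable {S : Type} {ar : S → ℕ} {k : ℕ}

instance instFiniteFact [Finite S] (A : PStruct S ar k) : Finite (Fact A) := by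
  unfold Fact; infer_instance

/-- Labels: `none` is ok, `some none` is replica of a distinguished element,
`some (some f)` is the branch through `f` fails. -/
abbrev Lbl (A : PStruct S ar k) : Type := Option (Option (Fact A))

variable {A : PStruct S ar k}

def IsRoot (O : Orient A) : A.dom ⊕ Fact A → Prop
  | Sum.inl u => ND A u ∧ O.up u = none
  | Sum.inr f => O.pos f = none

def Valid (O : Orient A) (ρ : A.dom ⊕ Fact A) (x : A.dom × Lbl A) : Prop :=
  (∀ l, ND A x.1 → x.2 = some l → ∃ f j, l = some f ∧ O.pos f = some j ∧ tup f j = x.1) ∧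
  (x.2 = none → ρ ≠ Sum.inl x.1)

def FactOK (O : Orient A) (ρ : A.dom ⊕ Fact A) (f : Fact A) (l : Fin (ar f.1) → Lbl A) : Prop :=
  (∃ j, O.pos f = some j ∧ l j ≠ some (some f)) ∨
  (∃ j, O.pos f ≠ some j ∧ l j ≠ none) ∨
  (O.pos f = none ∧ ρ ≠ Sum.inr f)

/-- The frontier structure associated with a root. -/
def front [Finite S] (O : Orient A) (ρ : A.dom ⊕ Fact A) (hρ : IsRoot O ρ) : PStruct S ar k where
  dom := {x : A.dom × Lbl A // Valid O ρ x}
  finite := inferInstance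
  facts R := {t | ∃ h : (fun j => (t j).1.1) ∈ A.facts R,
    FactOK O ρ ⟨R, ⟨_, h⟩⟩ (fun j => (t j).1.2)}
  dist i := ⟨(A.dist i, none), by
    refine ⟨fun l h => absurd rfl (h i), fun _ h => ?_⟩
    subst h
    exact hρ.1 i rfl⟩

theorem front_homTo [Finite S] (O : Orient A) (ρ : A.dom ⊕ Fact A) (hρ : IsRoot O ρ) :
    HomTo (front O ρ hρ) A :=
  ⟨fun x => x.1.1, fun _ _ ht => ht.1, fun _ => rfl⟩

theorem IsHom.comp {A B C : PStruct S ar k} {g : B.dom → C.dom} {f : A.dom → B.dom}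
    (hg : IsHom B C g) (hf : IsHom A B f) : IsHom A C (fun x => g (f x)) :=
  ⟨fun R t ht => hg.1 R _ (hf.1 R t ht), fun i => by
    change g (f (A.dist i)) = _
    rw [hf.2, hg.2]⟩

theorem IsHom.iterate {e : A.dom → A.dom} (he : IsHom A A e) (n : ℕ) : IsHom A A (e^[n]) := by
  induction n with
  | zero => exact ⟨fun R t ht => ht, fun i => rfl⟩
  | succ n ih => exact ih.comp he

theorem front_not_homTo [Finite S] (O : Orient A) (ρ : A.dom ⊕ Fact A) (hρ : IsRoot O ρ)
    (hcore : ∀ e, IsHom A A e → Function.Surjective e) : ¬ HomTo A (front O ρ hρ) := by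
  classical
  rintro ⟨g0, hg0⟩
  -- make it a section
  obtain ⟨g, hg, hsec⟩ : ∃ g, IsHom A (front O ρ hρ) g ∧ ∀ u, (g u).1.1 = u := by
    have he : IsHom A A (fun u => (g0 u).1.1) :=
      IsHom.comp (B := front O ρ hρ) (g := fun x => x.1.1) ⟨fun _ _ ht => ht.1, fun _ => rfl⟩ hg0
    have hb : Function.Bijective (fun u => (g0 u).1.1) :=
      Finite.injective_iff_bijective.1 (Finite.injective_iff_surjective.2 (hcore _ he))
    let e := Equiv.ofBijective _ hb
    have ho : IsOfFinOrder (e : Equiv.Perm A.dom) := isOfFinOrder_of_finite _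
    have hpos := ho.orderOf_pos
    have hone : (e : Equiv.Perm A.dom) ^ (orderOf (e : Equiv.Perm A.dom) - 1 + 1) = 1 := by
      rw [Nat.sub_add_cancel hpos]; exact pow_orderOf_eq_one _
    refine ⟨fun u => g0 ((fun u => (g0 u).1.1)^[orderOf (e : Equiv.Perm A.dom) - 1] u),
      hg0.comp (he.iterate _), fun u => ?_⟩
    have := congrArg (fun p : Equiv.Perm A.dom => p u) hone
    simp only [Equiv.Perm.coe_one, id] at this
    rw [← Equiv.Perm.iterate_eq_pow, Function.iterate_succ_apply'] at this
    exact this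
  have hfact : ∀ f : Fact A, FactOK O ρ f (fun j => (g (tup f j)).1.2) := by
    rintro ⟨R, t, ht⟩
    obtain ⟨h1, h2⟩ := hg.1 R t ht
    have : (fun j => (g (t j)).1.1) = t := funext fun j => hsec _
    have key : ∀ (t' : Fin (ar R) → A.dom) (h : t' ∈ A.facts R) , t' = t →
        FactOK O ρ ⟨R, ⟨t', h⟩⟩ (fun j => (g (t j)).1.2) →
        FactOK O ρ ⟨R, ⟨t, ht⟩⟩ (fun j => (g (t j)).1.2) := by
      rintro t' h rfl h'; exact h'
    exact key _ h1 this h2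
  have hdist : ∀ i, (g (A.dist i)).1.2 = none := fun i => by rw [hg.2 i]; rfl
  have hok : ∀ u, (g u).1.2 = none := by
    by_contra hcon
    push Not at hcon
    obtain ⟨u, hu, hmax⟩ := Set.exists_max_image {u | (g u).1.2 ≠ none} O.rE (Set.toFinite _) hcon
    have hnd : ND A u := fun i hi => hu (hi ▸ hdist i)
    obtain ⟨l, hl⟩ := Option.ne_none_iff_exists'.1 hu
    obtain ⟨f, j, rfl, hpos, htup⟩ := (g u).2.1 l (by rw [hsec]; exact hnd) hl
    rw [hsec] at htup
    subst htup
    rcases hfact f with ⟨j', h1, h2⟩ | ⟨j', h1, h2⟩ | ⟨h1, h2⟩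
    · rw [hpos] at h1
      cases h1
      exact h2 hl
    · have hnd' : ND A (tup f j') := fun i hi => h2 (by simp only [hi]; exact hdist i)
      have := hmax _ h2
      have a := O.pos_lt _ _ hpos
      have b := O.up_lt _ _ hnd' h1
      omega
    · rw [h1] at hpos; cases hpos
  rcases ρ with u | f
  · exact (g u).2.2 (hok u) (by rw [hsec])
  · rcases hfact f with ⟨j', h1, h2⟩ | ⟨j', h1, h2⟩ | ⟨h1, h2⟩
    · have : O.pos f = none := hρ
      rw [this] at h1; cases h1
    · exact h2 (hok _)
    · exact h2 rfl

def Sat (O : Orient A) (C : PStruct S ar k) (P : A.dom → C.dom → Prop) (f : Fact A)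
    (s : Fin (ar f.1) → C.dom) : Prop :=
  s ∈ C.facts f.1 ∧ (∀ j i, tup f j = A.dist i → s j = C.dist i) ∧
    ∀ j, ND A (tup f j) → O.pos f ≠ some j → P (tup f j) (s j)

inductive Good (O : Orient A) (C : PStruct S ar k) : A.dom → C.dom → Prop
  | mk (u : A.dom) (c : C.dom) (s : (p : {p : Σ f : Fact A, Fin (ar f.1) //
        O.pos p.1 = some p.2 ∧ tup p.1 p.2 = u}) → Fin (ar p.1.1.1) → C.dom)
      (h1 : ∀ p, s p p.1.2 = c)
      (h2 : ∀ p, s p ∈ C.facts p.1.1.1)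
      (h3 : ∀ p, ∀ j i, tup p.1.1 j = A.dist i → s p j = C.dist i)
      (h4 : ∀ p, ∀ j, ND A (tup p.1.1 j) → O.pos p.1.1 ≠ some j → Good O C (tup p.1.1 j) (s p j)) :
      Good O C u c

theorem good_iff (O : Orient A) (C : PStruct S ar k) (u : A.dom) (c : C.dom) :
    Good O C u c ↔ ∀ f j, O.pos f = some j → tup f j = u →
      ∃ s, s j = c ∧ Sat O C (Good O C) f s := by
  constructor
  · rintro ⟨_, _, s, h1, h2, h3, h4⟩ f j hp ht
    exact ⟨s ⟨⟨f, j⟩, hp, ht⟩, h1 ⟨⟨f, j⟩, hp, ht⟩, h2 ⟨⟨f, j⟩, hp, ht⟩, h3 ⟨⟨f, j⟩, hp, ht⟩,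
      h4 ⟨⟨f, j⟩, hp, ht⟩⟩
  · intro h
    have h' : ∀ p : {p : Σ f : Fact A, Fin (ar f.1) // O.pos p.1 = some p.2 ∧ tup p.1 p.2 = u},
      ∃ s : Fin (ar p.1.1.1) → C.dom, s p.1.2 = c ∧ Sat O C (Good O C) p.1.1 s :=
      fun p => h _ _ p.2.1 p.2.2
    choose s hs using h'
    exact ⟨u, c, s, fun p => (hs p).1, fun p => (hs p).2.1, fun p => (hs p).2.2.1,
      fun p => (hs p).2.2.2⟩

open Classical in
noncomputable def buildHom (O : Orient A) (C : PStruct S ar k) (d : A.dom → C.dom)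
    (σ : (f : Fact A) → Fin (ar f.1) → C.dom)
    (τ : (f : Fact A) → C.dom → Fin (ar f.1) → C.dom) (u : A.dom) : C.dom :=
  if ND A u then
    match O.up u with
    | none => d u
    | some ⟨f, j⟩ =>
      match O.pos f with
      | none => σ f j
      | some j' => if _h : O.rE (tup f j') < O.rE u then
          τ f (buildHom O C d σ τ (tup f j')) j else d u
  else d u
termination_by O.rE u

theorem homTo_of_good (hU : UNP A) (O : Orient A) (C : PStruct S ar k)
    (hE : ∀ u, ND A u → O.up u = none → ∃ c, Good O C u c)
    (hF : ∀ f, O.pos f = none → ∃ s, Sat O C (Good O C) f s) : HomTo A C := by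
  classical
  have hne : ∀ n, ∀ u, O.rE u = n → Nonempty C.dom := by
    intro n
    induction n using Nat.strong_induction_on with
    | _ n ih =>
      rintro u rfl
      by_cases hn : ND A u
      · cases hup : O.up u with
        | none => obtain ⟨c, -⟩ := hE u hn hup; exact ⟨c⟩
        | some p =>
          obtain ⟨f, j⟩ := p
          obtain ⟨rfl, h2⟩ := O.up_some _ _ _ hup
          cases hp : O.pos f with
          | none => obtain ⟨s, -⟩ := hF f hp; exact ⟨s j⟩
          | some j' =>
            exact ih _ (lt_trans (O.pos_lt _ _ hp) (O.up_lt _ _ hn h2)) _ rfl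
      · simp only [ND, not_forall, not_not] at hn
        obtain ⟨i, -⟩ := hn
        exact ⟨C.dist i⟩
  have hd : ∀ u, ∃ c : C.dom, (∀ i, u = A.dist i → c = C.dist i) ∧
      (ND A u → O.up u = none → Good O C u c) := by
    intro u
    by_cases hn : ND A u
    · by_cases hup : O.up u = none
      · obtain ⟨c, hc⟩ := hE u hn hup
        exact ⟨c, fun i hi => absurd hi (hn i), fun _ _ => hc⟩
      · obtain ⟨c⟩ := hne _ u rfl
        exact ⟨c, fun i hi => absurd hi (hn i), fun _ h => absurd h hup⟩
    · have hn' := hn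
      simp only [ND, not_forall, not_not] at hn'
      obtain ⟨i, rfl⟩ := hn'
      exact ⟨C.dist i, fun i' hi => by rw [hU hi], fun h => absurd h hn⟩
  choose d hd1 hd2 using hd
  have hσ : ∀ f : Fact A, ∃ s : Fin (ar f.1) → C.dom, O.pos f = none → Sat O C (Good O C) f s := by
    intro f
    by_cases hp : O.pos f = none
    · obtain ⟨s, hs⟩ := hF f hp; exact ⟨s, fun _ => hs⟩
    · exact ⟨fun j => d (tup f j), fun h => absurd h hp⟩
  choose σ hσ using hσ
  have hτ : ∀ (f : Fact A) (c : C.dom), ∃ s : Fin (ar f.1) → C.dom, ∀ j, O.pos f = some j →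
      Good O C (tup f j) c → s j = c ∧ Sat O C (Good O C) f s := by
    intro f c
    by_cases h : ∃ j, O.pos f = some j ∧ Good O C (tup f j) c
    · obtain ⟨j, hp, hg⟩ := h
      obtain ⟨s, hs⟩ := (good_iff O C _ _).1 hg f j hp rfl
      refine ⟨s, fun j' hj' _ => ?_⟩
      rw [hp] at hj'
      cases hj'
      exact hs
    · exact ⟨fun _ => c, fun j hp hg => absurd ⟨j, hp, hg⟩ h⟩
  choose τ hτ using hτ
  let g := buildHom O C d σ τ
  have g_dist : ∀ i, g (A.dist i) = C.dist i := by
    intro i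
    have : ¬ ND A (A.dist i) := fun h => h i rfl
    simp only [g]
    rw [buildHom, if_neg this]
    exact hd1 _ i rfl
  have g_none : ∀ u, ND A u → O.up u = none → g u = d u := by
    intro u hn hu
    simp only [g]
    rw [buildHom, if_pos hn, hu]
  have g_root : ∀ f j, ND A (tup f j) → O.pos f = none → g (tup f j) = σ f j := by
    intro f j hn hp
    simp only [g]
    rw [buildHom, if_pos hn, O.up_eq f j hn (by rw [hp]; simp)]
    simp only
    rw [hp]
  have g_some : ∀ f j j', ND A (tup f j) → O.pos f = some j' → j' ≠ j →
      g (tup f j) = τ f (g (tup f j')) j := by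
    intro f j j' hn hp hne
    have hne' : O.pos f ≠ some j := by rw [hp]; simpa using hne
    have hlt := lt_trans (O.pos_lt _ _ hp) (O.up_lt _ _ hn hne')
    simp only [g]
    rw [buildHom, if_pos hn, O.up_eq f j hn hne']
    simp only
    rw [hp]
    simp only [hlt, dif_pos]
  have g_good : ∀ n, ∀ u, O.rE u = n → ND A u → Good O C u (g u) := by
    intro n
    induction n using Nat.strong_induction_on with
    | _ n ih =>
      rintro u rfl hn
      cases hup : O.up u with
      | none => rw [g_none u hn hup]; exact hd2 u hn hup
      | some p =>
        obtain ⟨f, j⟩ := p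
        obtain ⟨rfl, h2⟩ := O.up_some _ _ _ hup
        cases hp : O.pos f with
        | none =>
          rw [g_root f j hn hp]
          exact (hσ f hp).2.2 j hn h2
        | some j' =>
          have := ih _ (lt_trans (O.pos_lt _ _ hp) (O.up_lt _ _ hn h2)) _ rfl (O.pos_nd _ _ hp)
          rw [g_some f j j' hn hp (by rintro rfl; exact h2 hp)]
          exact (hτ f _ j' hp this).2.2.2 j hn h2
  refine ⟨g, fun R t ht => ?_, g_dist⟩
  let f : Fact A := ⟨R, t, ht⟩
  change (fun j => g (tup f j)) ∈ C.facts f.1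
  cases hp : O.pos f with
  | none =>
    have hs := hσ f hp
    convert hs.1 using 1
    funext j
    by_cases hn : ND A (tup f j)
    · exact g_root f j hn hp
    · simp only [ND, not_forall, not_not] at hn
      obtain ⟨i, hi⟩ := hn
      rw [hs.2.1 j i hi, hi, g_dist]
  | some j' =>
    have hs := hτ f _ j' hp (g_good _ _ rfl (O.pos_nd _ _ hp))
    convert hs.2.1 using 1
    funext j
    by_cases hn : ND A (tup f j)
    · by_cases hj : j' = j
      · subst hj; exact hs.1.symm
      · exact g_some f j j' hn hp hj
    · simp only [ND, not_forall, not_not] at hn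
      obtain ⟨i, hi⟩ := hn
      rw [hs.2.2.1 j i hi, hi, g_dist]

theorem homTo_front [Finite S] (hU : UNP A) (O : Orient A) (C : PStruct S ar k)
    (h : C.dom → A.dom) (hh : IsHom C A h) (ρ : A.dom ⊕ Fact A) (hρ : IsRoot O ρ)
    (hE : ∀ u, ρ = Sum.inl u → ¬ ∃ c, Good O C u c)
    (hF : ∀ f, ρ = Sum.inr f → ¬ ∃ s, Sat O C (Good O C) f s) : HomTo C (front O ρ hρ) := by
  classical
  have hl : ∀ c : C.dom, ∃ l : Lbl A, Valid O ρ (h c, l) ∧ (ND A (h c) → l = none → Good O C (h c) c) ∧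
      (ND A (h c) → ∀ f, l = some (some f) → ∀ j, O.pos f = some j → tup f j = h c →
        ¬ ∃ s, s j = c ∧ Sat O C (Good O C) f s) ∧
      (¬ ND A (h c) → (l = none ↔ ∃ i, c = C.dist i)) := by
    intro c
    by_cases hn : ND A (h c)
    · by_cases hg : Good O C (h c) c
      · refine ⟨none, ⟨fun l _ hl => by simp at hl, fun _ hr => hE _ hr ⟨c, hg⟩⟩, fun _ _ => hg,
          fun _ f hf => by simp at hf, fun h => absurd hn h⟩
      · have hg' := hg
        rw [good_iff] at hg'
        push Not at hg'
        obtain ⟨f, j, hp, ht, hs⟩ := hg'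
        refine ⟨some (some f), ⟨fun l _ hl => ⟨f, j, ?_, hp, ht⟩, fun h => by simp at h⟩,
          fun _ h => by simp at h, ?_, fun h => absurd hn h⟩
        · simpa using hl.symm
        · rintro _ f' hf' j' hp' ht' ⟨s, hs1, hs2⟩
          simp only [Option.some.injEq] at hf'
          subst hf'
          rw [hp] at hp'
          cases hp'
          exact hs s hs1 hs2
    · by_cases hi : ∃ i, c = C.dist i
      · refine ⟨none, ⟨fun l h => absurd h hn, fun _ hr => ?_⟩, fun h => absurd h hn,
          fun h => absurd h hn, fun _ => by simpa using hi⟩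
        subst hr
        exact hn hρ.1
      · exact ⟨some none, ⟨fun l h => absurd h hn, fun h => by simp at h⟩, fun h => absurd h hn,
          fun h => absurd h hn, fun _ => by simpa using hi⟩
  choose l hv hgood hbad hdist using hl
  refine ⟨fun c => ⟨(h c, l c), hv c⟩, fun R s hs => ⟨hh.1 R s hs, ?_⟩, fun i => ?_⟩
  · by_contra hcon
    simp only [FactOK, not_or, not_exists, not_and, not_not] at hcon
    obtain ⟨c1, c2, c3⟩ := hcon
    let f : Fact A := ⟨R, _, hh.1 R s hs⟩
    have hsat : Sat O C (Good O C) f s := by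
      refine ⟨hs, ?_, ?_⟩
      · intro j i hi
        have hp : O.pos f ≠ some j := fun hp => O.pos_nd f j hp i hi
        have hnn : ¬ ND A (h (s j)) := fun hn => hn i hi
        obtain ⟨i', hi'⟩ := (hdist _ hnn).1 (c2 j hp)
        have : A.dist i' = A.dist i := by
          rw [← hh.2 i', ← hi']; exact hi
        rw [hi', hU this]
      · intro j hn hp
        exact hgood _ hn (c2 j hp)
    cases hp : O.pos f with
    | none => exact hF f (c3 hp) ⟨s, hsat⟩
    | some j =>
      exact hbad _ (O.pos_nd f j hp) f (c1 j hp) j hp rfl ⟨s, rfl, hsat⟩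
  · have hnn : ¬ ND A (h (C.dist i)) := fun hn => hn i (hh.2 i)
    have := (hdist _ hnn).2 ⟨i, rfl⟩
    apply Subtype.ext
    exact Prod.ext (hh.2 i) this

theorem size_front [Finite S] (O : Orient A) (ρ : A.dom ⊕ Fact A) (hρ : IsRoot O ρ) (r : ℕ)
    (hr : ∀ R, ar R ≤ r) : size (front O ρ hρ) ≤ size A * (size A + 2) ^ r := by
  classical
  have : Fintype (Fact A) := Fintype.ofFinite _
  let φ : Fact (front O ρ hρ) → Σ f : Fact A, (Fin (ar f.1) → Lbl A) := fun F =>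
    ⟨⟨F.1, ⟨_, F.2.2.1⟩⟩, fun j => (F.2.1 j).1.2⟩
  have hφ : Function.Injective φ := by
    rintro ⟨R, t, ht⟩ ⟨R', t', ht'⟩ heq
    have hR : R = R' := congrArg (fun x => x.1.1) heq
    subst hR
    have heq := Sigma.mk.inj heq
    have e1 : (fun j => (t j).1.1) = (fun j => (t' j).1.1) := by
      have := Sigma.mk.inj heq.1
      exact congrArg Subtype.val (eq_of_heq this.2)
    have e2 : (fun j => (t j).1.2) = (fun j => (t' j).1.2) := eq_of_heq heq.2
    have : t = t' := funext fun j => Subtype.ext (Prod.ext (congrFun e1 j) (congrFun e2 j))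
    subst this
    rfl
  have h1 : size (front O ρ hρ) ≤ Nat.card (Σ f : Fact A, (Fin (ar f.1) → Lbl A)) :=
    Nat.card_le_card_of_injective φ hφ
  refine h1.trans ?_
  rw [Nat.card_eq_fintype_card, Fintype.card_sigma]
  have hs : size A = Fintype.card (Fact A) := Nat.card_eq_fintype_card
  rw [hs]
  refine (Finset.sum_le_card_nsmul _ _ ((Fintype.card (Fact A) + 2) ^ r) fun f _ => ?_).trans ?_
  · simp only [Fintype.card_fun, Fintype.card_option, Fintype.card_fin]
    exact Nat.pow_le_pow_right (by omega) (hr f.1)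
  · simp [Finset.card_univ]

theorem core_case [Finite S] (hA : CAcyclic A) (hU : UNP A) (r : ℕ) (hr : ∀ R, ar R ≤ r)
    (hcore : ∀ e, IsHom A A e → Function.Surjective e) :
    ∃ F, IsFrontier Set.univ A F ∧
      totalSize F ≤ (size A + 1) * (size A * (size A + 2) ^ r + 1) := by
  classical
  obtain ⟨O⟩ := exists_orient A hA
  let Rt := {ρ : A.dom ⊕ Fact A // IsRoot O ρ}
  let B : Rt → PStruct S ar k := fun ρ => front O ρ.1 ρ.2
  refine ⟨Set.range B, ⟨Set.finite_range B, ?_, ?_, ?_⟩, ?_⟩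
  · rintro _ ⟨ρ, rfl⟩; exact front_homTo _ _ _
  · rintro _ ⟨ρ, rfl⟩; exact front_not_homTo _ _ _ hcore
  · rintro C - ⟨h, hh⟩ hn
    by_cases hE : ∀ u, ND A u → O.up u = none → ∃ c, Good O C u c
    · by_cases hF : ∀ f, O.pos f = none → ∃ s, Sat O C (Good O C) f s
      · exact absurd (homTo_of_good hU O C hE hF) hn
      · push Not at hF
        obtain ⟨f, hf, hbad⟩ := hF
        refine ⟨_, ⟨⟨Sum.inr f, hf⟩, rfl⟩, homTo_front hU O C h hh _ _ ?_ ?_⟩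
        · intro u hu; cases hu
        · rintro f' hf' ⟨s, hs⟩; cases hf'; exact hbad s hs
    · push Not at hE
      obtain ⟨u, h1, h2, hbad⟩ := hE
      refine ⟨_, ⟨⟨Sum.inl u, h1, h2⟩, rfl⟩, homTo_front hU O C h hh _ _ ?_ ?_⟩
      · rintro f' hf' ⟨s, hs⟩; cases hf'; exact hbad s hs
      · intro u hu; cases hu
  · -- isolated elements are unique
    have hiso : ∀ u v, ND A u → O.up u = none → ND A v → O.up v = none → u = v := by
      intro u v hu hu' hv hv'
      by_contra hne
      have : IsHom A A (fun x => if x = u then v else x) := by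
        refine ⟨fun R t ht => ?_, fun i => ?_⟩
        · have : (fun j => if t j = u then v else t j) = t := by
            funext j
            exact if_neg (O.up_none u hu hu' ⟨R, t, ht⟩ j)
          simp only [this]
          exact ht
        · exact if_neg (hu i).symm
      obtain ⟨x, hx⟩ := hcore _ this u
      by_cases hxu : x = u
      · simp [hxu] at hx; exact hne hx.symm
      · simp [hxu] at hx
    let ψ : Rt → Option (Fact A) := fun ρ => Sum.elim (fun _ => none) some ρ.1
    have hψ : Function.Injective ψ := by
      rintro ⟨u | f, h⟩ ⟨v | g, h'⟩ heq
      · have := hiso u v h.1 h.2 h'.1 h'.2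
        subst this; rfl
      · simp [ψ] at heq
      · simp [ψ] at heq
      · simp only [ψ, Sum.elim_inr, Option.some.injEq] at heq
        subst heq; rfl
    have hcard : Nat.card Rt ≤ size A + 1 := by
      refine (Nat.card_le_card_of_injective ψ hψ).trans ?_
      rw [Finite.card_option]
      rfl
    have hfin : (Set.range B).Finite := Set.finite_range B
    unfold totalSize
    rw [finsum_mem_eq_finite_toFinset_sum _ hfin]
    have hc2 : hfin.toFinset.card ≤ size A + 1 := by
      rw [← Set.ncard_eq_toFinset_card _ hfin, ← Nat.card_coe_set_eq]
      exact (Finite.card_range_le B).trans hcard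
    calc _ ≤ hfin.toFinset.card • (size A * (size A + 2) ^ r + 1) := by
          refine Finset.sum_le_card_nsmul _ _ _ fun b hb => ?_
          rw [Set.Finite.mem_toFinset] at hb
          obtain ⟨ρ, rfl⟩ := hb
          exact Nat.add_le_add_right (size_front _ _ _ r hr) 1
      _ ≤ _ := by
          rw [smul_eq_mul]
          exact Nat.mul_le_mul_right _ hc2

/-- The induced substructure on the range of an endomorphism. -/
def sub (A : PStruct S ar k) (e : A.dom → A.dom) (he : IsHom A A e) : PStruct S ar k where
  dom := Set.range e
  finite := inferInstance
  facts R := {t | (fun j => (t j).1) ∈ A.facts R}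
  dist i := ⟨A.dist i, A.dist i, he.2 i⟩

theorem sub_cacyclic (hA : CAcyclic A) (e : A.dom → A.dom) (he : IsHom A A e) :
    CAcyclic (sub A e he) := by
  let φF : Fact (sub A e he) → Fact A := fun f => ⟨f.1, ⟨_, f.2.2⟩⟩
  let φO : Occ (sub A e he) → Occ A := fun o => ⟨o.1, ⟨_, o.2.1.2⟩, o.2.2⟩
  let φ : IncV (sub A e he) → IncV A := Sum.map Subtype.val (Sum.map φO φF)
  have hF : Function.Injective φF := by
    rintro ⟨R, t, ht⟩ ⟨R', t', ht'⟩ heq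
    have hR : R = R' := congrArg (fun x => x.1) heq
    subst hR
    have heq := Sigma.mk.inj heq
    have e1 := congrArg Subtype.val (eq_of_heq heq.2)
    have : t = t' := funext fun j => Subtype.ext (congrFun e1 j)
    subst this
    rfl
  have hO : Function.Injective φO := by
    rintro ⟨R, ⟨t, ht⟩, j⟩ ⟨R', ⟨t', ht'⟩, j'⟩ heq
    have hR : R = R' := congrArg (fun x => x.1) heq
    subst hR
    have heq := Sigma.mk.inj heq
    have heq := eq_of_heq heq.2
    have heq := Prod.mk.inj heq
    have e1 := congrArg Subtype.val heq.1
    have : t = t' := funext fun j => Subtype.ext (congrFun e1 j)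
    subst this
    have : j = j' := heq.2
    subst this
    rfl
  have hφ : Function.Injective φ :=
    Subtype.val_injective.sumMap (hO.sumMap hF)
  let Φ : incGraph (sub A e he) →g incGraph A := ⟨φ, by
    rintro v w ⟨o, h⟩
    refine ⟨φO o, ?_⟩
    rcases h with ⟨rfl, rfl⟩ | ⟨rfl, rfl⟩ | ⟨rfl, rfl⟩ | ⟨rfl, rfl⟩
    · exact Or.inl ⟨rfl, rfl⟩
    · exact Or.inr (Or.inl ⟨rfl, rfl⟩)
    · exact Or.inr (Or.inr (Or.inl ⟨rfl, rfl⟩))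
    · exact Or.inr (Or.inr (Or.inr ⟨rfl, rfl⟩))⟩
  intro v c hc
  obtain ⟨i, hi⟩ := hA _ (c.map Φ) ((SimpleGraph.Walk.isCycle_map_iff_of_injective hφ).2 hc)
  refine ⟨i, ?_⟩
  rw [SimpleGraph.Walk.support_map] at hi
  obtain ⟨x, hx, hxi⟩ := List.mem_map.1 hi
  have : x = Sum.inl ((sub A e he).dist i) := hφ hxi
  rw [← this]
  exact hx

theorem main_aux [Finite S] (r : ℕ) (hr : ∀ R, ar R ≤ r) (n : ℕ) :
    ∀ A : PStruct S ar k, Nat.card A.dom = n → CAcyclic A → UNP A →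
    ∃ F, IsFrontier Set.univ A F ∧
      totalSize F ≤ (size A + 1) * (size A * (size A + 2) ^ r + 1) := by
  induction n using Nat.strong_induction_on with
  | _ n ih =>
    rintro A rfl hA hU
    by_cases hcore : ∀ e, IsHom A A e → Function.Surjective e
    · exact core_case hA hU r hr hcore
    · push Not at hcore
      obtain ⟨e, he, hns⟩ := hcore
      have hlt : Nat.card (sub A e he).dom < Nat.card A.dom := by
        refine Finite.card_subtype_lt (p := fun x => x ∈ Set.range e) (x := ?_) ?_
        · exact (not_forall.1 hns).choose
        · exact (not_forall.1 hns).choose_spec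
      have hUs : UNP (sub A e he) := fun i j hij => hU (congrArg Subtype.val hij)
      obtain ⟨F, ⟨h1, h2, h3, h4⟩, hF⟩ := ih _ hlt (sub A e he) rfl (sub_cacyclic hA e he) hUs
      have to1 : HomTo (sub A e he) A := ⟨Subtype.val, fun _ _ ht => ht, fun _ => rfl⟩
      have to2 : HomTo A (sub A e he) :=
        ⟨fun x => ⟨e x, x, rfl⟩, fun R t ht => he.1 R t ht, fun i => Subtype.ext (he.2 i)⟩
      have tr : ∀ {X Y Z : PStruct S ar k}, HomTo X Y → HomTo Y Z → HomTo X Z := by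
        rintro X Y Z ⟨f, hf⟩ ⟨g, hg⟩; exact ⟨_, hg.comp hf⟩
      refine ⟨F, ⟨h1, fun B hB => tr (h2 B hB) to1, fun B hB h => h3 B hB (tr to1 h), ?_⟩, ?_⟩
      · intro C hC hCA hAC
        exact h4 C hC (tr hCA to2) fun h => hAC (tr to2 h)
      · have hs : size (sub A e he) ≤ size A := by
          refine Nat.card_le_card_of_injective
            (fun f : Fact (sub A e he) => (⟨f.1, ⟨_, f.2.2⟩⟩ : Fact A)) ?_
          rintro ⟨R, t, ht⟩ ⟨R', t', ht'⟩ heq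
          have hR : R = R' := congrArg (fun x => x.1) heq
          subst hR
          have heq := Sigma.mk.inj heq
          have e1 := congrArg Subtype.val (eq_of_heq heq.2)
          have : t = t' := funext fun j => Subtype.ext (congrFun e1 j)
          subst this
          rfl
        refine hF.trans ?_
        gcongr

end PStruct

/-- Every c-acyclic structure with the UNP has a finite frontier w.r.t. the class of all
finite structures, consisting of structures with the UNP; moreover (for fixed schema and k)
such a frontier can be constructed in polynomial time, in particular it has total size
bounded by a fixed polynomial in the size of the structure. -/
theorem stmt_6 (S : Type) [Finite S] (ar : S → ℕ) (k : ℕ) :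
    ∃ p : Polynomial ℕ, ∀ A : PStruct S ar k, CAcyclic A → UNP A →
      ∃ F, IsFrontier Set.univ A F ∧ (∀ B ∈ F, UNP B) ∧
        totalSize F ≤ p.eval (size A) := by
  classical
  obtain ⟨r, hr⟩ : ∃ r, ∀ R, ar R ≤ r := by
    obtain ⟨r, hr⟩ := (Set.finite_range ar).bddAbove
    exact ⟨r, fun R => hr ⟨R, rfl⟩⟩
  refine ⟨(Polynomial.X + 1) * (Polynomial.X * (Polynomial.X + 2) ^ r + 1), fun A hA hU => ?_⟩
  obtain ⟨F, hF, hs⟩ := main_aux r hr _ A rfl hA hU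
  refine ⟨F, hF, ?_, ?_⟩
  · intro B hB i j hij
    obtain ⟨h, hh⟩ := hF.2.1 B hB
    exact hU (by rw [← hh.2 i, ← hh.2 j, hij])
  · simpa using hs
end

section
/- The class of c-connected acyclic finite structures with 1 distinguished element is frontier-closed: every c-connected acyclic structure (A,a) with one distinguished element has a frontier, with respect to this class, consisting of c-connected acyclic structures with one distinguished element; moreover this frontier can be constructed in polynomial time, and its total size is O(size(A)^4). -/
open PStruct

namespace Frt

open SimpleGraph

theorem acyclic_of_rank {V : Type*} (G : SimpleGraph V) (r : V → ℕ)
    (hne : ∀ u v, G.Adj u v → r u ≠ r v)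
    (huniq : ∀ v u w, G.Adj v u → G.Adj v w → r u < r v → r w < r v → u = w) :
    G.IsAcyclic := by
  classical
  intro v0 c0 hc0
  obtain ⟨v, hv, hmax⟩ := c0.support.toFinset.exists_max_image r ⟨v0, by simp⟩
  rw [List.mem_toFinset] at hv
  have hc := hc0.rotate hv
  have hmem : ∀ u, u ∈ (c0.rotate v hv).support → r u ≤ r v := by
    intro u hu
    exact hmax u (by rw [List.mem_toFinset]; exact (c0.mem_support_rotate_iff v hv).1 hu)
  set c := c0.rotate v hv
  have h1 : G.Adj v c.snd := c.adj_snd hc.not_nil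
  have h2 : G.Adj c.penultimate v := c.adj_penultimate hc.not_nil
  apply hc.snd_ne_penultimate
  apply huniq v _ _ h1 h2.symm
  · exact lt_of_le_of_ne (hmem _ (c.getVert_mem_support 1)) (hne _ _ h1).symm
  · exact lt_of_le_of_ne (hmem _ (c.getVert_mem_support _)) (hne _ _ h2)

theorem tree_unique_closer {V : Type*} (G : SimpleGraph V) (hG : G.IsTree) (r : V) (v u w : V)
    (hu : G.Adj v u) (hw : G.Adj v w) (h1 : G.dist r u < G.dist r v)
    (h2 : G.dist r w < G.dist r v) : u = w := by
  obtain ⟨p, hp, hp'⟩ := hG.connected.exists_path_of_dist r v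
  have key : ∀ x, G.Adj v x → G.dist r x < G.dist r v → x = p.penultimate := by
    intro x hx hlt
    obtain ⟨q, hq, hq'⟩ := hG.connected.exists_path_of_dist r x
    have hv : v ∉ q.support := by
      classical
      intro hv
      have := q.length_takeUntil_le_length hv
      have := G.dist_le (q.takeUntil v hv)
      omega
    exact hG.isAcyclic.eq_penultimate_of_adj_end hp hx
      (hG.isAcyclic.mem_support_of_ne_mem_support_of_adj_of_isPath hp hq hx hv)
  rw [key u hu h1, key w hw h2]

theorem tree_exists_closer {V : Type*} (G : SimpleGraph V) (hG : G.IsTree) (r : V) (v : V)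
    (hv : v ≠ r) : ∃ u, G.Adj v u ∧ G.dist r u < G.dist r v := by
  obtain ⟨p, hp, hp'⟩ := hG.connected.exists_path_of_dist r v
  have hn : ¬ p.Nil := Walk.not_nil_of_ne hv.symm
  refine ⟨p.penultimate, (p.adj_penultimate hn).symm, ?_⟩
  have := G.dist_le p.dropLast
  have h3 := p.length_dropLast_add_one hn
  omega

variable {S : Type} {ar : S → ℕ}

/-- `d` orients the incidence forest of `X`. -/
structure Forest (X : PStruct S ar 1) (d : X.dom → ℕ) : Prop where
  top : ∀ f : Fact X, ∃ p, ∀ q, q ≠ p → d (f.2.1 p) < d (f.2.1 q)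
  uniq : ∀ o o' : Occ X, o.elem = o'.elem → (∃ p, d (o.2.1.1 p) < d o.elem) →
    (∃ p, d (o'.2.1.1 p) < d o'.elem) → o = o'

structure Rooted (X : PStruct S ar 1) (z : X.dom) (d : X.dom → ℕ) : Prop extends Forest X d where
  root : d z = 0
  par : ∀ x, x ≠ z → ∃ o : Occ X, o.elem = x ∧ ∃ p, d (o.2.1.1 p) < d x

/-- The occurrence of position `p` in fact `f`. -/
def mkOcc {X : PStruct S ar 1} (f : Fact X) (p : Fin (ar f.1)) : Occ X := ⟨f.1, f.2, p⟩

theorem mkOcc_inj {X : PStruct S ar 1} {f : Fact X} {p q : Fin (ar f.1)}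
    (h : mkOcc f p = mkOcc f q) : p = q :=
  congrArg Prod.snd (eq_of_heq (Sigma.mk.inj h).2)

theorem adj_elem_occ {X : PStruct S ar 1} (o : Occ X) :
    (incGraph X).Adj (Sum.inl o.elem) (Sum.inr (Sum.inl o)) := ⟨o, by tauto⟩

theorem adj_occ_fact {X : PStruct S ar 1} (o : Occ X) :
    (incGraph X).Adj (Sum.inr (Sum.inl o)) (Sum.inr (Sum.inr o.fact)) := ⟨o, by tauto⟩

theorem adj_elem_iff {X : PStruct S ar 1} (x : X.dom) (v : IncV X) :
    (incGraph X).Adj (Sum.inl x) v ↔ ∃ o : Occ X, o.elem = x ∧ v = Sum.inr (Sum.inl o) := by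
  constructor
  · rintro ⟨o, (⟨h1, h2⟩ | ⟨h1, h2⟩ | ⟨h1, h2⟩ | ⟨h1, h2⟩)⟩
    · exact ⟨o, (Sum.inl.inj h1).symm, h2⟩
    · exact absurd h2 Sum.inl_ne_inr
    · exact absurd h1 Sum.inl_ne_inr
    · exact absurd h2 Sum.inl_ne_inr
  · rintro ⟨o, rfl, rfl⟩; exact adj_elem_occ o

theorem adj_fact_iff {X : PStruct S ar 1} (f : Fact X) (v : IncV X) :
    (incGraph X).Adj (Sum.inr (Sum.inr f)) v ↔ ∃ p, v = Sum.inr (Sum.inl (mkOcc f p)) := by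
  constructor
  · rintro ⟨o, (⟨h1, h2⟩ | ⟨h1, h2⟩ | ⟨h1, h2⟩ | ⟨h1, h2⟩)⟩
    · exact absurd h1 Sum.inr_ne_inl
    · exact absurd (Sum.inr.inj h2) Sum.inr_ne_inl
    · exact absurd (Sum.inr.inj h1) Sum.inr_ne_inl
    · have := Sum.inr.inj (Sum.inr.inj h2)
      subst this
      exact ⟨o.2.2, h1⟩
  · rintro ⟨p, rfl⟩; exact (adj_occ_fact (mkOcc f p)).symm

theorem adj_occ_iff {X : PStruct S ar 1} (o : Occ X) (v : IncV X) :
    (incGraph X).Adj (Sum.inr (Sum.inl o)) v ↔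
      v = Sum.inl o.elem ∨ v = Sum.inr (Sum.inr o.fact) := by
  constructor
  · rintro ⟨o', (⟨h1, h2⟩ | ⟨h1, h2⟩ | ⟨h1, h2⟩ | ⟨h1, h2⟩)⟩
    · exact absurd h1 Sum.inr_ne_inl
    · have := Sum.inl.inj (Sum.inr.inj h2)
      subst this
      exact Or.inl h1
    · have := Sum.inl.inj (Sum.inr.inj h1)
      subst this
      exact Or.inr h2
    · exact absurd (Sum.inr.inj h2) Sum.inl_ne_inr
  · rintro (rfl | rfl)
    · exact (adj_elem_occ o).symm
    · exact adj_occ_fact o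

theorem exists_rooted (X : PStruct S ar 1) (hc : CConnected X) (ha : Acyclic X) (z : X.dom) :
    ∃ d, Rooted X z d := by
  have hT : (incGraph X).IsTree := by
    have hr : ∀ v, (incGraph X).Reachable (Sum.inl (X.dist 0)) v := by
      intro v
      obtain ⟨i, hi⟩ := hc v
      rwa [Subsingleton.elim i 0] at hi
    refine ⟨?_, ha⟩
    have : Nonempty (IncV X) := ⟨Sum.inl z⟩
    exact ⟨fun u v => (hr u).symm.trans (hr v)⟩
  let δ : IncV X → ℕ := fun v => (incGraph X).dist (Sum.inl z) v
  have hU : ∀ v u w, (incGraph X).Adj v u → (incGraph X).Adj v w → δ u < δ v → δ w < δ v → u = w :=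
    tree_unique_closer _ hT _
  have hE : ∀ v : IncV X, v ≠ Sum.inl z → ∃ u, (incGraph X).Adj v u ∧ δ u < δ v :=
    tree_exists_closer _ hT _
  have hN : ∀ u v, (incGraph X).Adj u v → δ u ≠ δ v := fun u v h => hT.dist_ne_of_adj _ h
  -- every fact has a unique top position
  have htop : ∀ f : Fact X, ∃ p, δ (Sum.inr (Sum.inl (mkOcc f p))) < δ (Sum.inr (Sum.inr f)) ∧
      δ (Sum.inl (f.2.1 p)) < δ (Sum.inr (Sum.inl (mkOcc f p))) ∧
      ∀ q, q ≠ p → δ (Sum.inr (Sum.inr f)) < δ (Sum.inr (Sum.inl (mkOcc f q))) ∧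
        δ (Sum.inr (Sum.inl (mkOcc f q))) < δ (Sum.inl (f.2.1 q)) := by
    intro f
    obtain ⟨u, hu, hlt⟩ := hE (Sum.inr (Sum.inr f)) Sum.inr_ne_inl
    obtain ⟨p, rfl⟩ := (adj_fact_iff _ _).1 hu
    refine ⟨p, hlt, ?_, ?_⟩
    · obtain ⟨w, hw, hwlt⟩ := hE (Sum.inr (Sum.inl (mkOcc f p))) Sum.inr_ne_inl
      rcases (adj_occ_iff _ _).1 hw with rfl | rfl
      · exact hwlt
      · exact absurd hlt (not_lt.2 hwlt.le)
    · intro q hq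
      have h1 : δ (Sum.inr (Sum.inr f)) < δ (Sum.inr (Sum.inl (mkOcc f q))) := by
        have hadj := adj_occ_fact (mkOcc f q)
        by_contra hcon
        have hlt' := lt_of_le_of_ne (not_lt.1 hcon) (hN _ _ hadj)
        have := hU _ _ _ hu hadj.symm hlt hlt'
        have := Sum.inl.inj (Sum.inr.inj this)
        exact hq (mkOcc_inj this).symm
      refine ⟨h1, ?_⟩
      have hadj := (adj_elem_occ (mkOcc f q)).symm
      by_contra hcon
      have hlt' := lt_of_le_of_ne (not_lt.1 hcon) (hN _ _ hadj).symm
      have := hU _ _ _ hadj (adj_occ_fact (mkOcc f q)) hlt' h1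
      exact Sum.inl_ne_inr this
  have hnt : ∀ o : Occ X, (∃ p, δ (Sum.inl (o.2.1.1 p)) < δ (Sum.inl o.elem)) →
      δ (Sum.inr (Sum.inl o)) < δ (Sum.inl o.elem) := by
    rintro o ⟨p, hp⟩
    obtain ⟨p0, h1, h2, h3⟩ := htop o.fact
    by_cases hq : o.2.2 = p0
    · by_cases hpp : p = p0
      · subst hpp
        rw [Occ.elem, hq] at hp
        exact absurd hp (lt_irrefl _)
      · have h4 := h3 p hpp
        rw [Occ.elem, hq] at hp
        have h5 := h4.1.trans h4.2
        have h6 := h2.trans h1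
        exact absurd (hp.trans h6) (not_lt.2 h5.le)
    · exact (h3 _ hq).2
  refine ⟨fun x => δ (Sum.inl x), ⟨⟨?_, ?_⟩, ?_, ?_⟩⟩
  · intro f
    obtain ⟨p, h1, h2, h3⟩ := htop f
    refine ⟨p, fun q hq => ?_⟩
    have := h3 q hq
    exact (h2.trans h1).trans (this.1.trans this.2)
  · intro o o' he h h'
    have a1 := hnt o h
    have a2 := hnt o' h'
    have b1 := adj_elem_occ o
    have b2 := adj_elem_occ o'
    rw [← he] at a2 b2
    exact Sum.inl.inj (Sum.inr.inj (hU _ _ _ b1 b2 a1 a2))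
  · exact SimpleGraph.dist_self
  · intro x hx
    obtain ⟨u, hu, hlt⟩ := hE (Sum.inl x) (fun h => hx (Sum.inl.inj h))
    obtain ⟨o, rfl, rfl⟩ := (adj_elem_iff _ _).1 hu
    refine ⟨o, rfl, ?_⟩
    obtain ⟨p, h1, h2, h3⟩ := htop o.fact
    refine ⟨p, ?_⟩
    by_cases hq : o.2.2 = p
    · have h2' : δ (Sum.inl o.elem) < δ (Sum.inr (Sum.inl o)) := by
        rw [← hq] at h2; exact h2
      exact absurd hlt (not_lt.2 h2'.le)
    · have := h3 _ hq
      exact (h2.trans h1).trans (this.1.trans this.2)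

theorem Forest.acyclic {X : PStruct S ar 1} {d : X.dom → ℕ} (hd : Forest X d) : Acyclic X := by
  classical
  choose tp htp using hd.top
  let r : IncV X → ℕ := fun v => match v with
    | Sum.inl x => 4 * d x
    | Sum.inr (Sum.inl o) =>
        4 * d (o.2.1.1 (tp o.fact)) + (if o.2.2 = tp o.fact then 1 else 3)
    | Sum.inr (Sum.inr f) => 4 * d (f.2.1 (tp f)) + 2
  have r1 : ∀ o : Occ X, o.2.2 = tp o.fact → r (Sum.inl o.elem) < r (Sum.inr (Sum.inl o)) ∧
      r (Sum.inr (Sum.inl o)) < r (Sum.inr (Sum.inr o.fact)) := by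
    intro o ho
    have e : o.elem = o.2.1.1 (tp o.fact) := by rw [← ho]; rfl
    constructor
    · simp only [r, if_pos ho, e]; omega
    · simp only [r, if_pos ho]
      change _ < 4 * d (o.2.1.1 (tp o.fact)) + 2
      omega
  have r2 : ∀ o : Occ X, o.2.2 ≠ tp o.fact → r (Sum.inr (Sum.inl o)) < r (Sum.inl o.elem) ∧
      r (Sum.inr (Sum.inr o.fact)) < r (Sum.inr (Sum.inl o)) ∧
      d (o.2.1.1 (tp o.fact)) < d o.elem := by
    intro o ho
    have e : d (o.2.1.1 (tp o.fact)) < d o.elem := htp o.fact _ ho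
    refine ⟨?_, ?_, e⟩
    · simp only [r, if_neg ho]; omega
    · simp only [r, if_neg ho]
      change 4 * d (o.2.1.1 (tp o.fact)) + 2 < _
      omega
  apply acyclic_of_rank _ r
  · have hocc : ∀ o v, (incGraph X).Adj (Sum.inr (Sum.inl o)) v → r (Sum.inr (Sum.inl o)) ≠ r v := by
      intro o v h
      by_cases ho : o.2.2 = tp o.fact
      · have := r1 o ho
        rcases (adj_occ_iff _ _).1 h with rfl | rfl
        · exact this.1.ne'
        · exact this.2.ne
      · have := r2 o ho
        rcases (adj_occ_iff _ _).1 h with rfl | rfl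
        · exact this.1.ne
        · exact this.2.1.ne'
    rintro (x | o | f) v h
    · obtain ⟨o, rfl, rfl⟩ := (adj_elem_iff _ _).1 h
      exact (hocc _ _ h.symm).symm
    · exact hocc _ _ h
    · obtain ⟨p, rfl⟩ := (adj_fact_iff _ _).1 h
      exact (hocc _ _ h.symm).symm
  · rintro (x | o | f) u w hu hw h1 h2
    · obtain ⟨o, ho, rfl⟩ := (adj_elem_iff _ _).1 hu
      obtain ⟨o', ho', rfl⟩ := (adj_elem_iff _ _).1 hw
      subst ho
      have n1 : o.2.2 ≠ tp o.fact := fun h => absurd h1 (not_lt.2 (r1 o h).1.le)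
      have n2 : o'.2.2 ≠ tp o'.fact := fun h => absurd h2 (not_lt.2 (ho' ▸ (r1 o' h).1.le))
      rw [hd.uniq o o' ho'.symm ⟨_, (r2 o n1).2.2⟩ ⟨_, (r2 o' n2).2.2⟩]
    · by_cases ho : o.2.2 = tp o.fact
      · have := r1 o ho
        rcases (adj_occ_iff _ _).1 hu with rfl | rfl <;> rcases (adj_occ_iff _ _).1 hw with rfl | rfl
        · rfl
        · exact absurd h2 (not_lt.2 this.2.le)
        · exact absurd h1 (not_lt.2 this.2.le)
        · rfl
      · have := r2 o ho
        rcases (adj_occ_iff _ _).1 hu with rfl | rfl <;> rcases (adj_occ_iff _ _).1 hw with rfl | rfl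
        · rfl
        · exact absurd h1 (not_lt.2 this.1.le)
        · exact absurd h2 (not_lt.2 this.1.le)
        · rfl
    · obtain ⟨p, rfl⟩ := (adj_fact_iff _ _).1 hu
      obtain ⟨q, rfl⟩ := (adj_fact_iff _ _).1 hw
      have key : ∀ p, r (Sum.inr (Sum.inl (mkOcc f p))) < r (Sum.inr (Sum.inr f)) → p = tp f := by
        intro p hp
        by_contra hne
        exact absurd hp (not_lt.2 (r2 (mkOcc f p) hne).2.1.le)
      rw [key p h1, key q h2]

/-- Occurrences without the membership proof. -/
def raw {X : PStruct S ar 1} (o : Occ X) : Σ R : S, (Fin (ar R) → X.dom) × Fin (ar R) :=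
  ⟨o.1, o.2.1.1, o.2.2⟩

theorem raw_inj {X : PStruct S ar 1} {o o' : Occ X} (h : raw o = raw o') : o = o' := by
  obtain ⟨R, ⟨t, ht⟩, p⟩ := o
  obtain ⟨R', ⟨t', ht'⟩, p'⟩ := o'
  obtain ⟨h1, h2⟩ := Sigma.mk.inj h
  dsimp at h1
  subst h1
  obtain ⟨h3, h4⟩ := Prod.mk.inj (eq_of_heq h2)
  dsimp at h3 h4
  subst h3 h4
  rfl

theorem fact_ext {X : PStruct S ar 1} {f g : Fact X}
    (h : (⟨f.1, f.2.1⟩ : Σ R : S, (Fin (ar R) → X.dom)) = ⟨g.1, g.2.1⟩) : f = g := by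
  obtain ⟨R, ⟨t, ht⟩⟩ := f
  obtain ⟨R', ⟨t', ht'⟩⟩ := g
  obtain ⟨h1, h2⟩ := Sigma.mk.inj h
  dsimp at h1
  subst h1
  have h3 := eq_of_heq h2
  dsimp at h3
  subst h3
  rfl

/-- `ι` preserves facts. -/
def Pres (X Y : PStruct S ar 1) (ι : X.dom → Y.dom) : Prop :=
  ∀ (R : S) (t : Fin (ar R) → X.dom), t ∈ X.facts R → (fun i => ι (t i)) ∈ Y.facts R

def mapFact {X Y : PStruct S ar 1} (ι : X.dom → Y.dom) (h : Pres X Y ι) (f : Fact X) : Fact Y :=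
  ⟨f.1, fun i => ι (f.2.1 i), h _ _ f.2.2⟩

theorem mapFact_inj {X Y : PStruct S ar 1} (ι : X.dom → Y.dom) (h : Pres X Y ι)
    (hi : Function.Injective ι) : Function.Injective (mapFact ι h) := by
  rintro ⟨R, ⟨t, ht⟩⟩ ⟨R', ⟨t', ht'⟩⟩ e
  obtain ⟨h1, h2⟩ := Sigma.mk.inj e
  dsimp at h1
  subst h1
  have h3 := Subtype.mk.inj (eq_of_heq h2)
  have : t = t' := by
    funext i
    exact hi (congrFun h3 i)
  subst this
  rfl

instance [Finite S] (X : PStruct S ar 1) : Finite (Fact X) :=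
  inferInstanceAs (Finite (Σ R : S, {t : Fin (ar R) → X.dom // t ∈ X.facts R}))

instance [Finite S] (X : PStruct S ar 1) : Finite (Occ X) :=
  inferInstanceAs (Finite (Σ R : S, {t : Fin (ar R) → X.dom // t ∈ X.facts R} × Fin (ar R)))

theorem size_le [Finite S] {X Y : PStruct S ar 1} (ι : X.dom → Y.dom) (h : Pres X Y ι)
    (hi : Function.Injective ι) : size X ≤ size Y :=
  Nat.card_le_card_of_injective _ (mapFact_inj ι h hi)

theorem Forest.pullback {X Y : PStruct S ar 1} {d : Y.dom → ℕ} (hd : Forest Y d)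
    (ι : X.dom → Y.dom) (h : Pres X Y ι) (hi : Function.Injective ι) :
    Forest X (fun x => d (ι x)) := by
  refine ⟨fun f => hd.top (mapFact ι h f), ?_⟩
  rintro ⟨R, ⟨t, ht⟩, p⟩ ⟨R', ⟨t', ht'⟩, p'⟩ he h1 h2
  have := hd.uniq (mkOcc (mapFact ι h ⟨R, ⟨t, ht⟩⟩) p) (mkOcc (mapFact ι h ⟨R', ⟨t', ht'⟩⟩) p')
    (congrArg ι he) h1 h2
  obtain ⟨e1, e2⟩ := Sigma.mk.inj this
  dsimp [mapFact] at e1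
  subst e1
  obtain ⟨e3, e4⟩ := Prod.mk.inj (eq_of_heq e2)
  have h3 := Subtype.mk.inj e3
  have e5 : t = t' := by
    funext i
    exact hi (congrFun h3 i)
  subst e5
  obtain rfl : p = p' := e4
  rfl

/-- Elements connected to the distinguished element. -/
inductive Reach (X : PStruct S ar 1) : X.dom → Prop
  | root (i : Fin 1) : Reach X (X.dist i)
  | step (R : S) (t : Fin (ar R) → X.dom) (ht : t ∈ X.facts R) (p q : Fin (ar R))
      (hp : Reach X (t p)) : Reach X (t q)

theorem cconn_of_reach (X : PStruct S ar 1) (hr : ∀ x, Reach X x)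
    (hp : ∀ R t, t ∈ X.facts R → 0 < ar R) : CConnected X := by
  have h1 : ∀ x, (incGraph X).Reachable (Sum.inl (X.dist 0)) (Sum.inl x) := by
    intro x
    induction hr x with
    | root i => rw [Subsingleton.elim i 0]; exact SimpleGraph.Reachable.refl _
    | step R t ht p q _ ih =>
      have a1 := adj_elem_occ (X := X) ⟨R, ⟨t, ht⟩, p⟩
      have a2 := adj_occ_fact (X := X) ⟨R, ⟨t, ht⟩, p⟩
      have a3 := adj_occ_fact (X := X) ⟨R, ⟨t, ht⟩, q⟩
      have a4 := adj_elem_occ (X := X) ⟨R, ⟨t, ht⟩, q⟩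
      exact (((ih.trans a1.reachable).trans a2.reachable).trans a3.symm.reachable).trans
        a4.symm.reachable
  have h2 : ∀ o, (incGraph X).Reachable (Sum.inl (X.dist 0)) (Sum.inr (Sum.inl o)) :=
    fun o => (h1 o.elem).trans (adj_elem_occ o).reachable
  rintro (x | o | f)
  · exact ⟨0, h1 x⟩
  · exact ⟨0, h2 o⟩
  · exact ⟨0, (h2 (mkOcc f ⟨0, hp _ _ f.2.2⟩)).trans (adj_occ_fact _).reachable⟩

/-- The top position of a fact. -/
noncomputable def tp {X : PStruct S ar 1} {d : X.dom → ℕ} (h : Forest X d) (f : Fact X) :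
    Fin (ar f.1) := (h.top f).choose

/-- The top element of a fact. -/
noncomputable def te {X : PStruct S ar 1} {d : X.dom → ℕ} (h : Forest X d) (f : Fact X) :
    X.dom := f.2.1 (tp h f)

theorem te_lt {X : PStruct S ar 1} {d : X.dom → ℕ} (h : Forest X d) (f : Fact X) (q : Fin (ar f.1))
    (hq : q ≠ tp h f) : d (te h f) < d (f.2.1 q) := (h.top f).choose_spec q hq

theorem te_le {X : PStruct S ar 1} {d : X.dom → ℕ} (h : Forest X d) (f : Fact X)
    (q : Fin (ar f.1)) : d (te h f) ≤ d (f.2.1 q) := by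
  by_cases hq : q = tp h f
  · rw [hq]; rfl
  · exact (te_lt h f q hq).le

theorem Forest.inj {X : PStruct S ar 1} {d : X.dom → ℕ} (h : Forest X d) (f : Fact X)
    {p q : Fin (ar f.1)} (he : f.2.1 p = f.2.1 q) : p = q := by
  by_cases h1 : p = tp h f
  · by_contra hne
    have := te_lt h f q (fun e => hne (h1.trans e.symm))
    rw [← he, h1] at this
    exact lt_irrefl _ this
  · by_cases h2 : q = tp h f
    · have := te_lt h f p h1
      rw [he, h2] at this
      exact absurd this (lt_irrefl _)
    · exact mkOcc_inj (h.uniq (mkOcc f p) (mkOcc f q) he ⟨_, te_lt h f p h1⟩ ⟨_, te_lt h f q h2⟩)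

theorem Rooted.te_par {X : PStruct S ar 1} {z : X.dom} {d : X.dom → ℕ} (h : Rooted X z d)
    {x : X.dom} (hx : x ≠ z) : ∃ (f : Fact X) (q : Fin (ar f.1)), f.2.1 q = x ∧
      q ≠ tp h.toForest f := by
  obtain ⟨o, ho, p, hp⟩ := h.par x hx
  refine ⟨o.fact, o.2.2, ho, fun e => ?_⟩
  have h1 := te_le h.toForest o.fact p
  have h2 : te h.toForest o.fact = x := by rw [← ho, te, ← e]; rfl
  rw [h2] at h1
  exact absurd hp (not_lt.2 h1)

theorem Rooted.ind {X : PStruct S ar 1} {z : X.dom} {d : X.dom → ℕ} (h : Rooted X z d)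
    (P : X.dom → Prop) (h0 : P z)
    (hs : ∀ f : Fact X, P (te h.toForest f) → ∀ q, q ≠ tp h.toForest f → P (f.2.1 q)) :
    ∀ x, P x := by
  intro x
  induction hn : d x using Nat.strong_induction_on generalizing x with
  | _ n ih =>
    by_cases hx : x = z
    · rw [hx]; exact h0
    · obtain ⟨f, q, rfl, hq⟩ := h.te_par hx
      exact hs f (ih _ (hn ▸ te_lt h.toForest f q hq) _ rfl) q hq

theorem Rooted.recursion {X : PStruct S ar 1} {z : X.dom} {d : X.dom → ℕ} (h : Rooted X z d)
    {β : Type} (r0 : β) (step : (f : Fact X) → β → Fin (ar f.1) → β) :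
    ∃ φ : X.dom → β, φ z = r0 ∧ ∀ (f : Fact X) (q : Fin (ar f.1)), q ≠ tp h.toForest f →
      φ (f.2.1 q) = step f (φ (te h.toForest f)) q := by
  classical
  choose pf pq he hq using fun (x : X.dom) (hx : x ≠ z) => h.te_par hx
  have hlt : ∀ x hx, d (te h.toForest (pf x hx)) < d x := by
    intro x hx
    have := te_lt h.toForest _ _ (hq x hx)
    rwa [he] at this
  let F : (x : X.dom) → ((y : X.dom) → d y < d x → β) → β := fun x ih =>
    if hx : x = z then r0 else step (pf x hx) (ih _ (hlt x hx)) (pq x hx)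
  let φ : X.dom → β := (measure d).wf.fix F
  have hφ : ∀ x, φ x = F x (fun y _ => φ y) := fun x => (measure d).wf.fix_eq F x
  refine ⟨φ, ?_, ?_⟩
  · rw [hφ]; simp [F]
  · intro f q hne
    have hlt' := te_lt h.toForest f q hne
    have hz : f.2.1 q ≠ z := by
      intro e
      rw [e, h.root] at hlt'
      exact absurd hlt' (Nat.not_lt_zero _)
    rw [hφ]
    simp only [F, dif_neg hz]
    have ho : mkOcc (pf _ hz) (pq _ hz) = mkOcc f q := by
      apply h.uniq
      · exact he _ hz
      · exact ⟨_, te_lt h.toForest _ _ (hq _ hz)⟩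
      · exact ⟨_, hlt'⟩
    have key : ∀ o : Occ X, o = mkOcc f q →
        step o.fact (φ (te h.toForest o.fact)) o.2.2 = step f (φ (te h.toForest f)) q := by
      rintro o rfl; rfl
    exact key _ ho

theorem Rooted.reach {X : PStruct S ar 1} {d : X.dom → ℕ} (h : Rooted X (X.dist 0) d) :
    ∀ x, Reach X x :=
  h.ind _ (Reach.root 0) fun f hf q _ => Reach.step f.1 f.2.1 f.2.2 _ q hf

theorem Forest.pos {X : PStruct S ar 1} {d : X.dom → ℕ} (h : Forest X d) (R : S)
    (t : Fin (ar R) → X.dom) (ht : t ∈ X.facts R) : 0 < ar R :=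
  Fin.pos (tp h (⟨R, ⟨t, ht⟩⟩ : Fact X))

theorem IsHom.reach {X Y : PStruct S ar 1} {φ : X.dom → Y.dom} (h : IsHom X Y φ) {x : X.dom}
    (hx : Reach X x) : Reach Y (φ x) := by
  induction hx with
  | root i => rw [h.2]; exact Reach.root i
  | step R t ht p q _ ih => exact Reach.step R _ (h.1 R t ht) p q ih

/-- The component of the distinguished element. -/
def comp (X : PStruct S ar 1) : PStruct S ar 1 where
  dom := {x : X.dom // Reach X x}
  finite := inferInstance
  facts R := {t | 0 < ar R ∧ (fun i => (t i).1) ∈ X.facts R}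
  dist i := ⟨X.dist i, Reach.root i⟩

theorem comp_reach (X : PStruct S ar 1) (x : X.dom) (hx : Reach X x) :
    Reach (comp X) (⟨x, hx⟩ : {x : X.dom // Reach X x}) := by
  induction hx with
  | root i => exact Reach.root (X := comp X) i
  | step R t ht p q hp ih =>
    have hall : ∀ i, Reach X (t i) := fun i => Reach.step R t ht p i hp
    exact Reach.step (X := comp X) R (fun i => ⟨t i, hall i⟩) ⟨Fin.pos p, ht⟩ p q ih

theorem comp_cconn (X : PStruct S ar 1) : CConnected (comp X) :=
  cconn_of_reach _ (fun x => comp_reach X x.1 x.2) (fun _ _ h => h.1)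

theorem comp_hom (X : PStruct S ar 1) : IsHom (comp X) X Subtype.val :=
  ⟨fun _ _ h => h.2, fun _ => rfl⟩

theorem comp_acyclic {X : PStruct S ar 1} {d : X.dom → ℕ} (h : Forest X d) : Acyclic (comp X) :=
  (h.pullback (X := comp X) Subtype.val (comp_hom X).1 Subtype.val_injective).acyclic

theorem hom_comp {X Y : PStruct S ar 1} {d : X.dom → ℕ} (h : Rooted X (X.dist 0) d)
    (hh : HomTo X Y) : HomTo X (comp Y) := by
  obtain ⟨φ, hφ⟩ := hh
  refine ⟨fun x => ⟨φ x, IsHom.reach hφ (h.reach x)⟩, ?_, ?_⟩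
  · intro R t ht
    exact ⟨h.toForest.pos R t ht, hφ.1 R t ht⟩
  · intro i
    exact Subtype.ext (hφ.2 i)

theorem HomTo.trans {X Y Z : PStruct S ar 1} (h : HomTo X Y) (h' : HomTo Y Z) : HomTo X Z := by
  obtain ⟨φ, hφ⟩ := h
  obtain ⟨ψ, hψ⟩ := h'
  exact ⟨fun x => ψ (φ x), fun R t ht => hψ.1 R _ (hφ.1 R t ht), fun i => (congrArg ψ (hφ.2 i)).trans (hψ.2 i)⟩

/-- The image of an endomorphism. -/
def img (A : PStruct S ar 1) (h : A.dom → A.dom) : PStruct S ar 1 where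
  dom := {x : A.dom // x ∈ Set.range h}
  finite := inferInstance
  facts R := {t | ∃ s ∈ A.facts R, ∀ i, (t i).1 = h (s i)}
  dist i := ⟨h (A.dist i), _, rfl⟩

theorem exists_core [Finite S] (n : ℕ) : ∀ A : PStruct S ar 1, CConnected A → Acyclic A →
    Nat.card A.dom = n → ∃ T : PStruct S ar 1, CConnected T ∧ Acyclic T ∧ HomTo A T ∧ HomTo T A ∧
      size T ≤ size A ∧ ∀ h, IsHom T T h → Function.Bijective h := by
  induction n using Nat.strong_induction_on with
  | _ n ih =>
    intro A hc ha hn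
    by_cases hcore : ∀ h, IsHom A A h → Function.Bijective h
    · exact ⟨A, hc, ha, ⟨id, fun _ _ h => h, fun _ => rfl⟩, ⟨id, fun _ _ h => h, fun _ => rfl⟩,
        le_rfl, hcore⟩
    · push Not at hcore
      obtain ⟨h, hh, hnb⟩ := hcore
      obtain ⟨d, hd⟩ := exists_rooted A hc ha (A.dist 0)
      have hval : IsHom (img A h) A Subtype.val := by
        refine ⟨?_, fun i => hh.2 i⟩
        rintro R t ⟨s, hs, hst⟩
        have : (fun i => (t i).1) = fun i => h (s i) := funext hst
        rw [this]
        exact hh.1 R s hs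
      have hto : IsHom A (img A h) (fun x => ⟨h x, x, rfl⟩) :=
        ⟨fun R t ht => ⟨t, ht, fun _ => rfl⟩, fun _ => rfl⟩
      have hc' : CConnected (img A h) := by
        apply cconn_of_reach
        · rintro ⟨_, x, rfl⟩
          exact IsHom.reach hto (hd.reach x)
        · rintro R t ⟨s, hs, -⟩
          exact hd.toForest.pos R s hs
      have ha' : Acyclic (img A h) :=
        (hd.toForest.pullback (X := img A h) Subtype.val hval.1 Subtype.val_injective).acyclic
      have hlt : Nat.card (img A h).dom < n := by
        rw [← hn]
        have hns : ¬ Function.Surjective h := fun hs => hnb (Finite.surjective_iff_bijective.1 hs)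
        rw [Function.Surjective] at hns
        push Not at hns
        obtain ⟨b, hb⟩ := hns
        exact Finite.card_subtype_lt (x := b) (by rintro ⟨x, hx⟩; exact hb x hx)
      obtain ⟨T, h1, h2, h3, h4, h5, h6⟩ := ih _ hlt (img A h) hc' ha' rfl
      refine ⟨T, h1, h2, HomTo.trans ⟨_, hto⟩ h3, HomTo.trans h4 ⟨_, hval⟩, ?_, h6⟩
      exact h5.trans (size_le (X := img A h) Subtype.val hval.1 Subtype.val_injective)

/-- Elements of the (disconnected) frontier structure. -/
abbrev D (T : PStruct S ar 1) : Type := Fact T ⊕ (Bool × Fact T × Occ T × T.dom)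

section Build

open Classical in
noncomputable def tup1 {T : PStruct S ar 1} {d : T.dom → ℕ} (hf : Forest T d) (f g : Fact T)
    (i : Fin (ar g.1)) : D T :=
  if g.2.1 i = te hf g then Sum.inl g else if g.2.1 i = te hf f then Sum.inl f
  else Sum.inr (true, f, mkOcc g i, g.2.1 i)

open Classical in
noncomputable def tup2 {T : PStruct S ar 1} {d : T.dom → ℕ} (hf : Forest T d) (f g : Fact T)
    (i : Fin (ar g.1)) : D T :=
  if g.2.1 i = te hf f then Sum.inl f else Sum.inr (false, f, mkOcc g i, g.2.1 i)

def tup0 {T : PStruct S ar 1} (b : Bool) (f : Fact T) (o : Occ T) (g : Fact T)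
    (i : Fin (ar g.1)) : D T := Sum.inr (b, f, o, g.2.1 i)

inductive BF {T : PStruct S ar 1} {d : T.dom → ℕ} (hf : Forest T d) :
    (Σ R : S, (Fin (ar R) → D T)) → Prop
  | c0 (b : Bool) (f : Fact T) (o : Occ T) (g : Fact T) : BF hf ⟨g.1, tup0 b f o g⟩
  | c1 (f g : Fact T) (i : Fin (ar g.1)) (hi : g.2.1 i = te hf f) (hne : i ≠ tp hf g) :
      BF hf ⟨g.1, tup1 hf f g⟩
  | c2 (f g : Fact T) (i : Fin (ar g.1)) (hi : g.2.1 i = te hf f) (hne : g ≠ f) :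
      BF hf ⟨g.1, tup2 hf f g⟩

variable {T : PStruct S ar 1} {d : T.dom → ℕ} (hf : Forest T d)

def BB [Finite S] (f0 : Fact T) : PStruct S ar 1 where
  dom := D T
  finite := inferInstance
  facts R := {s | BF hf ⟨R, s⟩}
  dist _ := Sum.inl f0

noncomputable def dB (dz : T.dom → T.dom → ℕ) : D T → ℕ
  | Sum.inl f => d (te hf f)
  | Sum.inr (_, f, o, x) => d (te hf f) + 1 + dz o.elem x

noncomputable def proj : D T → T.dom
  | Sum.inl f => te hf f
  | Sum.inr (_, _, _, x) => x

theorem tup1_top (f g : Fact T) {i : Fin (ar g.1)} (h : g.2.1 i = te hf g) :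
    tup1 hf f g i = Sum.inl g := by simp [tup1, h]

theorem tup1_mid (f g : Fact T) {i : Fin (ar g.1)} (h : i ≠ tp hf g) (h2 : g.2.1 i = te hf f) :
    tup1 hf f g i = Sum.inl f := by
  have : g.2.1 i ≠ te hf g := fun e => h (hf.inj g e)
  rw [tup1, if_neg this, if_pos h2]

theorem tup1_oth (f g : Fact T) {i : Fin (ar g.1)} (h : i ≠ tp hf g) (h2 : g.2.1 i ≠ te hf f) :
    tup1 hf f g i = Sum.inr (true, f, mkOcc g i, g.2.1 i) := by
  have : g.2.1 i ≠ te hf g := fun e => h (hf.inj g e)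
  rw [tup1, if_neg this, if_neg h2]

theorem tup2_top (f g : Fact T) {i : Fin (ar g.1)} (h2 : g.2.1 i = te hf f) :
    tup2 hf f g i = Sum.inl f := by rw [tup2, if_pos h2]

theorem tup2_oth (f g : Fact T) {i : Fin (ar g.1)} (h2 : g.2.1 i ≠ te hf f) :
    tup2 hf f g i = Sum.inr (false, f, mkOcc g i, g.2.1 i) := by rw [tup2, if_neg h2]

theorem proj_tup1 (f g : Fact T) (i : Fin (ar g.1)) : proj hf (tup1 hf f g i) = g.2.1 i := by
  unfold tup1
  split_ifs with h1 h2
  · exact h1.symm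
  · exact h2.symm
  · rfl

theorem proj_tup2 (f g : Fact T) (i : Fin (ar g.1)) : proj hf (tup2 hf f g i) = g.2.1 i := by
  unfold tup2
  split_ifs with h2
  · exact h2.symm
  · rfl

theorem BF_proj (v : Σ R : S, (Fin (ar R) → D T)) (h : BF hf v) :
    (fun i => proj hf (v.2 i)) ∈ T.facts v.1 := by
  rcases h with ⟨b, f, o, g⟩ | ⟨f, g, i, hi, hne⟩ | ⟨f, g, i, hi, hne⟩
  · exact g.2.2
  · simp only [proj_tup1]; exact g.2.2
  · simp only [proj_tup2]; exact g.2.2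

theorem BB_hom [Finite S] (f0 : Fact T) (h0 : te hf f0 = T.dist 0) :
    IsHom (BB hf f0) T (proj hf) := by
  refine ⟨fun R s hs => BF_proj hf ⟨R, s⟩ hs, fun i => ?_⟩
  rw [Subsingleton.elim i 0]
  exact h0

variable (dz : T.dom → T.dom → ℕ)

theorem te_of_mid (f g : Fact T) {i : Fin (ar g.1)} (h : i ≠ tp hf g) (h2 : g.2.1 i = te hf f) :
    d (te hf g) < d (te hf f) := by
  have := te_lt hf g i h
  rwa [h2] at this

theorem BF_top (hz : ∀ z, Rooted T z (dz z)) (v : Σ R : S, (Fin (ar R) → D T)) (h : BF hf v) :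
    ∃ p, ∀ q, q ≠ p → dB hf dz (v.2 p) < dB hf dz (v.2 q) := by
  rcases h with ⟨b, f, o, g⟩ | ⟨f, g, i, hi, hne⟩ | ⟨f, g, i, hi, hne⟩
  · refine ⟨tp (hz o.elem).toForest g, fun q hq => ?_⟩
    have := te_lt (hz o.elem).toForest g q hq
    exact Nat.add_lt_add_left this _
  · refine ⟨tp hf g, fun q hq => ?_⟩
    have hlt := te_of_mid hf f g hne hi
    have e1 := tup1_top hf f g (i := tp hf g) rfl
    by_cases h2 : g.2.1 q = te hf f
    · have e2 := tup1_mid hf f g hq h2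
      simp only [e1, e2]
      exact hlt
    · have e2 := tup1_oth hf f g hq h2
      simp only [e1, e2, dB]
      omega
  · refine ⟨i, fun q hq => ?_⟩
    have e1 := tup2_top hf f g hi
    have h2 : g.2.1 q ≠ te hf f := fun e => hq (hf.inj g (e.trans hi.symm))
    have e2 := tup2_oth hf f g h2
    simp only [e1, e2, dB]
    omega

/-- Tuples with a position. -/
abbrev RO (T : PStruct S ar 1) : Type := Σ R : S, (Fin (ar R) → D T) × Fin (ar R)

theorem BF_key (v : Σ R : S, (Fin (ar R) → D T)) (h : BF hf v) (q : Fin (ar v.1))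
    (hq : ∃ p, dB hf dz (v.2 p) < dB hf dz (v.2 q)) :
    (∃ (f g : Fact T) (i : Fin (ar g.1)), (⟨v.1, v.2, q⟩ : RO T) = ⟨g.1, tup1 hf f g, i⟩ ∧
      g.2.1 i = te hf f ∧ d (te hf g) < d (te hf f) ∧ v.2 q = Sum.inl f) ∨
    (∃ (b : Bool) (f : Fact T) (o : Occ T), v.2 q = Sum.inr (b, f, o, o.elem) ∧
      (⟨v.1, v.2, q⟩ : RO T) =
        ⟨o.1, if b = true then tup1 hf f o.fact else tup2 hf f o.fact, o.2.2⟩) ∨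
    (∃ (b : Bool) (f : Fact T) (o o' : Occ T), v.2 q = Sum.inr (b, f, o, o'.elem) ∧
      (∃ p, dz o.elem (o'.2.1.1 p) < dz o.elem o'.elem) ∧
      (⟨v.1, v.2, q⟩ : RO T) = ⟨o'.1, tup0 b f o o'.fact, o'.2.2⟩) := by
  obtain ⟨p, hp⟩ := hq
  rcases h with ⟨b, f, o, g⟩ | ⟨f, g, i, hi, hne⟩ | ⟨f, g, i, hi, hne⟩
  · refine Or.inr (Or.inr ⟨b, f, o, mkOcc g q, rfl, ⟨p, ?_⟩, rfl⟩)
    exact Nat.lt_of_add_lt_add_left hp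
  · have hlt := te_of_mid hf f g hne hi
    by_cases h1 : q = tp hf g
    · exfalso
      have e1 := tup1_top hf f g (i := q) (by rw [h1]; rfl)
      simp only [e1, dB] at hp
      by_cases h3 : p = tp hf g
      · have e3 := tup1_top hf f g (i := p) (by rw [h3]; rfl)
        simp only [e3] at hp
        omega
      · by_cases h4 : g.2.1 p = te hf f
        · have e3 := tup1_mid hf f g h3 h4
          simp only [e3] at hp
          omega
        · have e3 := tup1_oth hf f g h3 h4
          simp only [e3] at hp
          omega
    · by_cases h2 : g.2.1 q = te hf f
      · exact Or.inl ⟨f, g, q, rfl, h2, hlt, tup1_mid hf f g h1 h2⟩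
      · exact Or.inr (Or.inl ⟨true, f, mkOcc g q, tup1_oth hf f g h1 h2, rfl⟩)
  · by_cases h2 : g.2.1 q = te hf f
    · exfalso
      have e1 := tup2_top hf f g h2
      simp only [e1, dB] at hp
      by_cases h4 : g.2.1 p = te hf f
      · have e3 := tup2_top hf f g h4
        simp only [e3] at hp
        omega
      · have e3 := tup2_oth hf f g h4
        simp only [e3] at hp
        omega
    · exact Or.inr (Or.inl ⟨false, f, mkOcc g q, tup2_oth hf f g h2, rfl⟩)

theorem BB_forest [Finite S] (hz : ∀ z, Rooted T z (dz z)) (f0 : Fact T) :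
    Forest (BB hf f0) (dB hf dz) := by
  refine ⟨fun F => BF_top hf dz hz ⟨F.1, F.2.1⟩ F.2.2, ?_⟩
  intro o1 o2 he h1 h2
  apply raw_inj
  have k1 := BF_key hf dz ⟨o1.1, o1.2.1.1⟩ o1.2.1.2 o1.2.2 h1
  have k2 := BF_key hf dz ⟨o2.1, o2.2.1.1⟩ o2.2.1.2 o2.2.2 h2
  change o1.2.1.1 o1.2.2 = o2.2.1.1 o2.2.2 at he
  dsimp only at k1 k2
  rw [← he] at k2
  generalize o1.2.1.1 o1.2.2 = x at k1 k2
  change raw o1 = raw o2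
  rcases k1 with ⟨f, g, i, r1, a1, b1, c1⟩ | ⟨b, f, o, c1, r1⟩ | ⟨b, f, o, o', c1, l1, r1⟩ <;>
  rcases k2 with ⟨f', g', i', r2, a2, b2, c2⟩ | ⟨b', f', w, c2, r2⟩ | ⟨b', f', w, w', c2, l2, r2⟩ <;>
  rw [c1] at c2
  · obtain rfl := Sum.inl.inj c2
    have : mkOcc g i = mkOcc g' i' := by
      apply hf.uniq
      · exact a1.trans a2.symm
      · refine ⟨tp hf g, ?_⟩
        change d (te hf g) < d (g.2.1 i)
        rw [a1]; exact b1
      · refine ⟨tp hf g', ?_⟩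
        change d (te hf g') < d (g'.2.1 i')
        rw [a2]; exact b2
    have key : ∀ o o' : Occ T, o = o' → (⟨o.1, tup1 hf f o.fact, o.2.2⟩ : RO T) =
        ⟨o'.1, tup1 hf f o'.fact, o'.2.2⟩ := by rintro o _ rfl; rfl
    exact r1.trans ((key _ _ this).trans r2.symm)
  · exact absurd c2 Sum.inl_ne_inr
  · exact absurd c2 Sum.inl_ne_inr
  · exact absurd c2 Sum.inr_ne_inl
  · have c3 := Sum.inr.inj c2
    simp only [Prod.mk.injEq] at c3
    obtain ⟨rfl, rfl, rfl, -⟩ := c3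
    exact r1.trans r2.symm
  · exfalso
    have c3 := Sum.inr.inj c2
    simp only [Prod.mk.injEq] at c3
    obtain ⟨rfl, rfl, rfl, e⟩ := c3
    obtain ⟨p, hp⟩ := l2
    rw [← e, (hz o.elem).root] at hp
    exact absurd hp (Nat.not_lt_zero _)
  · exact absurd c2 Sum.inr_ne_inl
  · exfalso
    have c3 := Sum.inr.inj c2
    simp only [Prod.mk.injEq] at c3
    obtain ⟨rfl, rfl, rfl, e⟩ := c3
    obtain ⟨p, hp⟩ := l1
    rw [e, (hz o.elem).root] at hp
    exact absurd hp (Nat.not_lt_zero _)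
  · have c3 := Sum.inr.inj c2
    simp only [Prod.mk.injEq] at c3
    obtain ⟨rfl, rfl, rfl, e⟩ := c3
    obtain rfl := (hz o.elem).uniq o' w' e l1 l2
    exact r1.trans r2.symm

theorem BB_no_section [Finite S] (f0 : Fact T) (h0 : te hf f0 = T.dist 0) (e : T.dom → D T)
    (he : IsHom T (BB hf f0) e) (hs : ∀ x, proj hf (e x) = x) : False := by
  obtain ⟨M, hM⟩ : ∃ M, ∀ x, d x ≤ M := by
    obtain ⟨M, hM⟩ := (Set.finite_range d).bddAbove
    exact ⟨M, fun x => hM ⟨x, rfl⟩⟩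
  have key : ∀ n (f : Fact T), M - d (te hf f) = n → e (te hf f) = Sum.inl f → False := by
    intro n
    induction n using Nat.strong_induction_on with
    | _ n ih =>
      intro f hn hef
      have hB : BF hf ⟨f.1, fun i => e (f.2.1 i)⟩ := he.1 f.1 f.2.1 f.2.2
      have hgen : ∀ v, BF hf v → v = ⟨f.1, fun i => e (f.2.1 i)⟩ →
          (∃ (b : Bool) (f' : Fact T) (o : Occ T), ∃ i, v.2 i = Sum.inl f ∧
              ∀ j, ∃ x, v.2 j = Sum.inr (b, f', o, x)) ∨
          (∃ (g : Fact T) (i : Fin (ar v.1)), v.2 i = Sum.inl g ∧ d (te hf f) < d (te hf g)) ∨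
          (∃ (f' g : Fact T), g ≠ f' ∧ g = f ∧ ∀ j x, v.2 j = Sum.inl x → x = f') := by
        intro v hv hve
        have hfact : ∀ g : Fact T, g.1 = v.1 → (⟨g.1, g.2.1⟩ : Σ R : S, (Fin (ar R) → T.dom)) =
            ⟨v.1, fun i => proj hf (v.2 i)⟩ → g = f := by
          intro g _ hg
          apply fact_ext
          rw [hg, hve]
          simp only [hs]
        rcases hv with ⟨b, f', o, g⟩ | ⟨f', g, i, hi, hne⟩ | ⟨f', g, i, hi, hne⟩
        · left
          have : ∃ i, (tup0 b f' o g) i = Sum.inl f := by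
            have h2 : ∃ i, (⟨f.1, fun i => e (f.2.1 i)⟩ : Σ R : S, (Fin (ar R) → D T)).2 i
              = Sum.inl f := ⟨tp hf f, hef⟩
            rw [← hve] at h2
            exact h2
          obtain ⟨i, hi⟩ := this
          exact ⟨b, f', o, i, hi, fun j => ⟨_, rfl⟩⟩
        · right; left
          have hg : g = f := hfact g rfl (by simp only [proj_tup1])
          subst hg
          exact ⟨f', i, tup1_mid hf f' g hne hi, te_of_mid hf f' g hne hi⟩
        · right; right
          refine ⟨f', g, hne, hfact g rfl (by simp only [proj_tup2]), ?_⟩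
          intro j x hx
          dsimp only at hx
          unfold tup2 at hx
          split_ifs at hx
          exact (Sum.inl.inj hx).symm
      rcases hgen _ hB rfl with ⟨b, f', o, i, hi, hall⟩ | ⟨g, i, hi, hlt⟩ | ⟨f', g, hne, hgf, hall⟩
      · obtain ⟨x, hx⟩ := hall i
        rw [hi] at hx
        exact absurd hx Sum.inl_ne_inr
      · have h1 : f.2.1 i = te hf g := by
          have := hs (f.2.1 i)
          dsimp only at hi
          rw [hi] at this
          exact this.symm
        refine ih (M - d (te hf g)) ?_ g rfl (by rw [← h1]; exact hi)
        have := hM (te hf g)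
        omega
      · have := hall (tp hf f) f hef
        exact hne (hgf.trans this)
  refine key _ f0 rfl ?_
  rw [h0]
  exact he.2 0

end Build

section Maps

variable {T : PStruct S ar 1} {d : T.dom → ℕ}

/-- The subtree of `T` hanging below `f` maps to `C`, with the top element sent to `x`. -/
inductive Sat (hf : Forest T d) (C : PStruct S ar 1) : Fact T → C.dom → Prop
  | mk (f : Fact T) (s : Fin (ar f.1) → C.dom) (hs : s ∈ C.facts f.1)
      (hc : ∀ (i : Fin (ar f.1)) (g : Fact T), i ≠ tp hf f → f.2.1 i = te hf g → Sat hf C g (s i)) :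
      Sat hf C f (s (tp hf f))

theorem Sat.inv {hf : Forest T d} {C : PStruct S ar 1} {f : Fact T} {x : C.dom}
    (h : Sat hf C f x) : ∃ s ∈ C.facts f.1, s (tp hf f) = x ∧
      ∀ (i : Fin (ar f.1)) (g : Fact T), i ≠ tp hf f → f.2.1 i = te hf g → Sat hf C g (s i) := by
  cases h with
  | mk _ s hs hc => exact ⟨s, hs, rfl, hc⟩

theorem hom_of_sat (h : Rooted T (T.dist 0) d) (C : PStruct S ar 1)
    (hall : ∀ f, te h.toForest f = T.dist 0 → Sat h.toForest C f (C.dist 0)) : HomTo T C := by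
  classical
  obtain ⟨φ, h0, hφ⟩ := h.recursion (C.dist 0) (fun f x =>
    if H : Sat h.toForest C f x then H.inv.choose else fun _ => x)
  have hJ : ∀ y, ∀ f, te h.toForest f = y → Sat h.toForest C f (φ y) := by
    apply h.ind
    · intro f hf; rw [h0]; exact hall f hf
    · intro f hP q hq g hg
      have H := hP f rfl
      rw [hφ f q hq, dif_pos H]
      exact H.inv.choose_spec.2.2 q g hq hg.symm
  refine ⟨φ, ?_, ?_⟩
  · intro R t ht
    let f : Fact T := ⟨R, ⟨t, ht⟩⟩
    have H := hJ _ f rfl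
    have : (fun i => φ (t i)) = H.inv.choose := by
      funext i
      by_cases hi : i = tp h.toForest f
      · rw [hi]; exact H.inv.choose_spec.2.1.symm
      · have := hφ f i hi
        rw [dif_pos H] at this
        exact this
    rw [this]
    exact H.inv.choose_spec.1
  · intro i
    rw [Subsingleton.elim i 0]; exact h0

theorem hom_to_BB [Finite S] (hf : Forest T d) {C : PStruct S ar 1} {dC : C.dom → ℕ}
    (hC : Rooted C (C.dist 0) dC) (f0 : Fact T) (h0 : te hf f0 = T.dist 0)
    (hn : ¬ Sat hf C f0 (C.dist 0)) (k : C.dom → T.dom) (hk : IsHom C T k) :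
    HomTo C (BB hf f0) := by
  classical
  let m : Fact C → Fact T := mapFact k hk.1
  let Q : Fact C → Fact T → Prop := fun g f' => ∃ i : Fin (ar g.1), i ≠ tp hf (m g) ∧
    k (g.2.1 i) = te hf f' ∧ ¬ Sat hf C f' (g.2.1 i)
  let step : (g : Fact C) → D T → Fin (ar g.1) → D T := fun g v => match v with
    | Sum.inl f => if m g = f then (if H : ∃ f', Q g f' then tup1 hf H.choose (m g)
        else fun _ => v) else tup2 hf f (m g)
    | Sum.inr (b, f, o, _) => tup0 b f o (m g)
  have step1 : ∀ (g : Fact C) (H : ∃ f', Q g f'),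
      step g (Sum.inl (m g)) = tup1 hf H.choose (m g) := by
    intro g H
    exact (if_pos rfl).trans (dif_pos H)
  have step2 : ∀ (g : Fact C) (f : Fact T), m g ≠ f →
      step g (Sum.inl f) = tup2 hf f (m g) := by
    intro g f hm
    exact if_neg hm
  obtain ⟨φ, hr, hφ⟩ := hC.recursion (Sum.inl f0) step
  let Inv : C.dom → Prop := fun x => proj hf (φ x) = k x ∧
    ∀ f, φ x = Sum.inl f → ¬ Sat hf C f x
  -- the existence of a failing child
  have hQ : ∀ g : Fact C, Inv (te hC.toForest g) → φ (te hC.toForest g) = Sum.inl (m g) →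
      tp hf (m g) = tp hC.toForest g ∧ ∃ f', Q g f' := by
    intro g hI he
    have e1 : te hf (m g) = k (te hC.toForest g) := by rw [← hI.1, he]; rfl
    have e2 : tp hf (m g) = tp hC.toForest g := hf.inj (m g) e1
    refine ⟨e2, ?_⟩
    by_contra hcon
    apply hI.2 _ he
    have := Sat.mk (hf := hf) (C := C) (m g) g.2.1 g.2.2 (by
      intro i f' hi hfi
      by_contra hns
      exact hcon ⟨f', i, hi, hfi, hns⟩)
    rw [e2] at this
    exact this
  have hI : ∀ x, Inv x := by
    apply hC.ind
    · refine ⟨?_, ?_⟩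
      · rw [hr, hk.2]; exact h0
      · intro f hf'
        rw [hr] at hf'
        obtain rfl := Sum.inl.inj hf'
        exact hn
    · intro g hP q hq
      have e := hφ g q hq
      rcases hv : φ (te hC.toForest g) with f | ⟨b, f, o, x⟩
      · rw [hv] at e
        by_cases hm : m g = f
        · subst hm
          obtain ⟨htp, H⟩ := hQ g hP hv
          have e' : φ (g.2.1 q) = tup1 hf H.choose (m g) q := by
            rw [e]; exact congrFun (step1 g H) q
          obtain ⟨i, hi1, hi2, hi3⟩ := H.choose_spec
          refine ⟨by rw [e']; exact proj_tup1 hf _ (m g) q, ?_⟩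
          intro f' hf'
          rw [e'] at hf'
          have hq' : q ≠ tp hf (m g) := by rw [htp]; exact hq
          by_cases h2 : (m g).2.1 q = te hf H.choose
          · rw [tup1_mid hf _ (m g) hq' h2] at hf'
            have hiq : i = q := hf.inj (m g) (hi2.trans h2.symm)
            rw [hiq] at hi3
            rw [← Sum.inl.inj hf']
            exact hi3
          · rw [tup1_oth hf _ (m g) hq' h2] at hf'
            exact absurd hf' Sum.inr_ne_inl
        · have e' : φ (g.2.1 q) = tup2 hf f (m g) q := by
            rw [e]; exact congrFun (step2 g f hm) q
          refine ⟨by rw [e']; exact proj_tup2 hf _ (m g) q, ?_⟩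
          intro f' hf'
          exfalso
          have h1 : (m g).2.1 (tp hC.toForest g) = te hf f := by
            have := hP.1
            rw [hv] at this
            exact this.symm
          have h2 : (m g).2.1 q ≠ te hf f := fun h => hq (hf.inj (m g) (h.trans h1.symm))
          rw [e', tup2_oth hf f (m g) h2] at hf'
          exact Sum.inr_ne_inl hf'
      · rw [hv] at e
        have e' : φ (g.2.1 q) = tup0 b f o (m g) q := e
        refine ⟨by rw [e']; rfl, ?_⟩
        intro f' hf'
        rw [e'] at hf'
        exact absurd hf' Sum.inr_ne_inl
  refine ⟨φ, ?_, fun i => by rw [Subsingleton.elim i 0]; exact hr⟩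
  intro R t ht
  let g : Fact C := ⟨R, ⟨t, ht⟩⟩
  have hP := hI (te hC.toForest g)
  change BF hf ⟨R, fun i => φ (t i)⟩
  rcases hv : φ (te hC.toForest g) with f | ⟨b, f, o, x⟩
  · have h1 : (m g).2.1 (tp hC.toForest g) = te hf f := by
      have := hP.1
      rw [hv] at this
      exact this.symm
    by_cases hm : m g = f
    · subst hm
      obtain ⟨htp, H⟩ := hQ g hP hv
      obtain ⟨i, hi1, hi2, hi3⟩ := H.choose_spec
      have : (fun i => φ (t i)) = tup1 hf H.choose (m g) := by
        funext q
        by_cases hq : q = tp hC.toForest g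
        · rw [tup1_top hf _ (m g) (i := q) (by rw [hq]; exact h1), ← hv, hq]
          rfl
        · have e := hφ g q hq
          rw [hv] at e
          rw [show φ (t q) = φ (g.2.1 q) from rfl, e]
          exact congrFun (step1 g H) q
      rw [this]
      exact BF.c1 _ (m g) i hi2 hi1
    · have : (fun i => φ (t i)) = tup2 hf f (m g) := by
        funext q
        by_cases hq : q = tp hC.toForest g
        · rw [tup2_top hf _ (m g) (i := q) (by rw [hq]; exact h1), ← hv, hq]
          rfl
        · have e := hφ g q hq
          rw [hv] at e
          rw [show φ (t q) = φ (g.2.1 q) from rfl, e]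
          exact congrFun (step2 g f hm) q
      rw [this]
      exact BF.c2 f (m g) _ h1 hm
  · have : (fun i => φ (t i)) = tup0 b f o (m g) := by
      funext q
      by_cases hq : q = tp hC.toForest g
      · have h2 := hP.1
        rw [hv] at h2
        rw [hq, show t (tp hC.toForest g) = te hC.toForest g from rfl, hv]
        simp only [proj] at h2
        rw [h2]
        rfl
      · have e := hφ g q hq
        rw [hv] at e
        exact e
    rw [this]
    exact BF.c0 b f o (m g)

theorem size_BB [Finite S] (hf : Forest T d) (f0 : Fact T) :
    size (BB hf f0) ≤ 2 * (size T * (Nat.card (Occ T) * size T)) + (size T * size T + size T * size T) := by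
  let Code := (Bool × Fact T × Occ T × Fact T) ⊕ ((Fact T × Fact T) ⊕ (Fact T × Fact T))
  let dec : Code → Σ R : S, (Fin (ar R) → D T) := fun c => match c with
    | Sum.inl (b, f, o, g) => ⟨g.1, tup0 b f o g⟩
    | Sum.inr (Sum.inl (f, g)) => ⟨g.1, tup1 hf f g⟩
    | Sum.inr (Sum.inr (f, g)) => ⟨g.1, tup2 hf f g⟩
  have hdec : ∀ v, BF hf v → ∃ c, dec c = v := by
    rintro v (⟨b, f, o, g⟩ | ⟨f, g, i, hi, hne⟩ | ⟨f, g, i, hi, hne⟩)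
    · exact ⟨Sum.inl (b, f, o, g), rfl⟩
    · exact ⟨Sum.inr (Sum.inl (f, g)), rfl⟩
    · exact ⟨Sum.inr (Sum.inr (f, g)), rfl⟩
  choose c hc using fun F : Fact (BB hf f0) => hdec ⟨F.1, F.2.1⟩ F.2.2
  have hinj : Function.Injective c := by
    intro F G h
    apply fact_ext
    exact (hc F).symm.trans ((congrArg dec h).trans (hc G))
  have := Nat.card_le_card_of_injective c hinj
  refine this.trans (le_of_eq ?_)
  simp only [Code, Nat.card_sum, Nat.card_prod, size]
  simp

theorem card_occ [Finite S] (T : PStruct S ar 1) (α : ℕ) (hα : ∀ R, ar R ≤ α) :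
    Nat.card (Occ T) ≤ size T * α := by
  have : Function.Injective (fun o : Occ T => (o.fact, Fin.castLE (hα o.1) o.2.2)) := by
    rintro ⟨R, t, p⟩ ⟨R', t', p'⟩ h
    obtain ⟨h1, h2⟩ := Prod.mk.inj h
    obtain ⟨h3, h4⟩ := Sigma.mk.inj h1
    dsimp at h3
    subst h3
    have h5 := eq_of_heq h4
    dsimp at h5
    subst h5
    have : p = p' := Fin.castLE_injective _ h2
    subst this
    rfl
  have := Nat.card_le_card_of_injective _ this
  simpa [Nat.card_prod, size] using this

end Maps

theorem core_no_hom [Finite S] {T : PStruct S ar 1}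
    (hcore : ∀ h, IsHom T T h → Function.Bijective h) {X : PStruct S ar 1} (π : X.dom → T.dom)
    (hπ : IsHom X T π) (h : HomTo T X) : ∃ e, IsHom T X e ∧ ∀ x, π (e x) = x := by
  obtain ⟨e, he⟩ := h
  let s : T.dom → T.dom := fun x => π (e x)
  have hs : IsHom T T s := ⟨fun R t ht => hπ.1 R _ (he.1 R t ht), fun i =>
    (congrArg π (he.2 i)).trans (hπ.2 i)⟩
  let σ : Equiv.Perm T.dom := Equiv.ofBijective s (hcore s hs)
  have hpow : ∀ n : ℕ, IsHom T T (fun x => (σ ^ n) x) := by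
    intro n
    induction n with
    | zero => exact ⟨fun _ _ h => h, fun _ => rfl⟩
    | succ n ih =>
      have e1 : (fun x => (σ ^ (n + 1)) x) = fun x => s ((σ ^ n) x) := by
        funext x
        rw [pow_succ']
        rfl
      rw [e1]
      exact ⟨fun R t ht => hs.1 R _ (ih.1 R t ht), fun i => (congrArg s (ih.2 i)).trans (hs.2 i)⟩
  have hfo : 0 < orderOf σ := orderOf_pos σ
  have h1 := hpow (orderOf σ - 1)
  refine ⟨fun x => e ((σ ^ (orderOf σ - 1)) x), ⟨fun R t ht => he.1 R _ (h1.1 R t ht), fun i =>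
    (congrArg e (h1.2 i)).trans (he.2 i)⟩, ?_⟩
  intro x
  change σ ((σ ^ (orderOf σ - 1)) x) = x
  rw [← Equiv.Perm.mul_apply, ← pow_succ', Nat.sub_add_cancel hfo, pow_orderOf_eq_one]
  rfl

theorem main_frontier [Finite S] (α : ℕ) (hα : ∀ R, ar R ≤ α) (A : PStruct S ar 1) (hAc : CConnected A)
    (hAa : Acyclic A) :
      ∃ F, IsFrontier {X : PStruct S ar 1 | CConnected X ∧ Acyclic X} A F ∧
        (∀ B ∈ F, CConnected B ∧ Acyclic B) ∧
        totalSize F ≤ (2 * α + 3) * (size A + 1) ^ 4 := by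
  obtain ⟨T, hTc, hTa, hAT, hTA, hsz, hcore⟩ := exists_core _ A hAc hAa rfl
  obtain ⟨d, hd⟩ := exists_rooted T hTc hTa (T.dist 0)
  choose dz hz using fun z => exists_rooted T hTc hTa z
  let hf := hd.toForest
  let P : Set (Fact T) := {f | te hf f = T.dist 0}
  let F : Set (PStruct S ar 1) := (fun f0 => comp (BB hf f0)) '' P
  have hfin : F.Finite := (Set.toFinite P).image _
  have hB : ∀ f0, Forest (BB hf f0) (dB hf dz) := fun f0 => BB_forest hf dz hz f0
  refine ⟨F, ⟨hfin, ?_, ?_, ?_⟩, ?_, ?_⟩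
  · rintro _ ⟨f0, h0, rfl⟩
    exact HomTo.trans (HomTo.trans ⟨_, comp_hom _⟩ ⟨_, BB_hom hf f0 h0⟩) hTA
  · rintro _ ⟨f0, h0, rfl⟩ hcon
    have h1 : HomTo T (BB hf f0) := HomTo.trans (HomTo.trans hTA hcon) ⟨_, comp_hom _⟩
    obtain ⟨e, he, hs⟩ := core_no_hom hcore _ (BB_hom hf f0 h0) h1
    exact BB_no_section hf f0 h0 e he hs
  · rintro C ⟨hCc, hCa⟩ hCA hAC
    obtain ⟨dC, hdC⟩ := exists_rooted C hCc hCa (C.dist 0)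
    obtain ⟨k, hk⟩ := HomTo.trans hCA hAT
    by_cases hall : ∀ f, te hd.toForest f = T.dist 0 → Sat hd.toForest C f (C.dist 0)
    · exact absurd (HomTo.trans hAT (hom_of_sat hd C hall)) hAC
    · push Not at hall
      obtain ⟨f0, h0, hn⟩ := hall
      exact ⟨_, ⟨f0, h0, rfl⟩, hom_comp hdC (hom_to_BB hf hdC f0 h0 hn k hk)⟩
  · rintro _ ⟨f0, h0, rfl⟩
    exact ⟨comp_cconn _, comp_acyclic (hB f0)⟩
  · have hbound : ∀ B ∈ F, size B + 1 ≤ (2 * α + 3) * (size A + 1) ^ 3 := by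
      rintro _ ⟨f0, h0, rfl⟩
      have h1 : size (comp (BB hf f0)) ≤ size (BB hf f0) :=
        size_le (X := comp (BB hf f0)) Subtype.val (comp_hom _).1 Subtype.val_injective
      have h2 := size_BB hf f0
      have h3 := card_occ T α hα
      generalize size T = n at *
      generalize size A = N at *
      generalize Nat.card (Occ T) = M at *
      have h4 : 2 * (n * (M * n)) + (n * n + n * n) ≤
          2 * (N * (N * α * N)) + (N * N + N * N) := by
        have : M ≤ N * α := h3.trans (Nat.mul_le_mul_right _ hsz)
        gcongr
      have h5 : 2 * (N * (N * α * N)) + (N * N + N * N) + 1 ≤ (2 * α + 3) * (N + 1) ^ 3 := by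
        have e : (2 * α + 3) * (N + 1) ^ 3 = 2 * (N * (N * α * N)) + (N * N + N * N) + 1 +
          (2 * α * (3 * N^2 + 3 * N + 1) + 3 * N^3 + 7 * N^2 + 9 * N + 2) := by ring
        omega
      change size (comp (BB hf f0)) + 1 ≤ _
      omega
    have hcard : F.ncard ≤ size A := by
      refine le_trans (Set.ncard_image_le (Set.toFinite P)) (le_trans ?_ hsz)
      have := Set.ncard_le_ncard (Set.subset_univ P) (Set.toFinite _)
      rwa [Set.ncard_univ] at this
    rw [totalSize, finsum_mem_eq_finite_toFinset_sum _ hfin]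
    refine (Finset.sum_le_card_nsmul _ _ ((2 * α + 3) * (size A + 1) ^ 3) ?_).trans ?_
    · intro B hB
      exact hbound B (hfin.mem_toFinset.1 hB)
    · rw [← Set.ncard_eq_toFinset_card F hfin, smul_eq_mul]
      calc F.ncard * ((2 * α + 3) * (size A + 1) ^ 3)
          ≤ (size A + 1) * ((2 * α + 3) * (size A + 1) ^ 3) :=
            Nat.mul_le_mul_right _ (hcard.trans (Nat.le_succ _))
        _ = _ := by ring

end Frt

/-- The class of c-connected acyclic structures with one distinguished element is
frontier-closed: every member has a frontier w.r.t. this class consisting of members of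
the class, of total size O(size^4) (and computable in polynomial time). -/
theorem stmt_7 (S : Type) [Finite S] (ar : S → ℕ) :
    ∃ c : ℕ, ∀ A : PStruct S ar 1, CConnected A → Acyclic A →
      ∃ F, IsFrontier {X : PStruct S ar 1 | CConnected X ∧ Acyclic X} A F ∧
        (∀ B ∈ F, CConnected B ∧ Acyclic B) ∧
        totalSize F ≤ c * (size A + 1) ^ 4 := by
  obtain ⟨α, hα⟩ := (Set.finite_range ar).bddAbove
  exact ⟨2 * α + 3, fun A h1 h2 => Frt.main_frontier α (fun R => hα ⟨R, rfl⟩) A h1 h2⟩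
end
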